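/- Let d, L₁, L₂, κ ∈ (0,∞), c₀ > 1, c₁ > 0, Γ = (L₁𝕋)×(L₂𝕋), Ω = Γ×(−d,0), Σ₊ = Γ×{0}, Σ₋ = Γ×{−d}. Let η̄ : [0,∞)×Γ×[−d,0] → ℝ be smooth; define d̃ = 1+x₃/d, A = ∂₁η̄·d̃, B = ∂₂η̄·d̃, J = 1+η̄/d+∂₃η̄·d̃, K = 1/J, 𝒜 the matrix with rows (1,0,−AK), (0,1,−BK), (0,0,K), η(t,·) = η̄(t,·,0), 𝒩 = (−∂₁η,−∂₂η,1). Assume 1/c₀ ≤ J ≤ c₀ and (1/c₁)|v|² ≤ (J𝒜ᵀ𝒜v)·v ≤ c₁|v|² pointwise for all v ∈ ℝ³ and all t. Let u : [0,∞)×Ω̄ → ℝ³ be smooth with div_𝒜 u = 0 in Ω, ∂ₜη = u·𝒩 on Σ₊, and u = 0 on Σ₋, and let θ : [0,∞)×Ω̄ → ℝ be a smooth bounded solution of ∂ₜθ − ∂ₜη̄·d̃·K·∂₃θ + u·∇_𝒜θ = κΔ_𝒜θ in Ω with ∇_𝒜θ·𝒩 = 0 on Σ₊ and ∂₃θ = 0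 on Σ₋. Set θ_avg = (∫_Ω J(0,x)dx)^{−1}∫_Ω θ(0,x)J(0,x)dx and μ̄₀ = κπ² min{1/d², 4/L₁², 4/L₂²}. Then for all t ≥ 0, ‖(θ(t,·)−θ_avg)√J(t,·)‖_{L²(Ω)} ≤ exp(−(μ̄₀/(c₀c₁)) t) ‖(θ(0,·)−θ_avg)√J(0,·)‖_{L²(Ω)}. -/

import Mathlib

open MeasureTheory Real Set

noncomputable section

/-- Partial derivative of `f : ℝ³ → ℝ` in the `i`-th coordinate direction. -/
def pd (i : Fin 3) (f : (Fin 3 → ℝ) → ℝ) (x : Fin 3 → ℝ) : ℝ :=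
  fderiv ℝ f x (Pi.single i 1)

/-- Fundamental domain `(0,L₁)×(0,L₂)×(−d,0)` of the periodic slab `Ω = Γ×(−d,0)`. -/
def slab (L₁ L₂ d : ℝ) : Set (Fin 3 → ℝ) :=
  Set.univ.pi ![Ioo 0 L₁, Ioo 0 L₂, Ioo (-d) 0]

/-- Wirtinger's inequality with Dirichlet boundary conditions. -/
theorem wirtinger_dirichlet {a b : ℝ} (hab : a < b) {F f : ℝ → ℝ}
    (hF : ∀ x, HasDerivAt F (f x) x) (hf : Continuous f) (ha : F a = 0) (hb : F b = 0) :
    (π / (b - a)) ^ 2 * ∫ x in a..b, F x ^ 2 ≤ ∫ x in a..b, f x ^ 2 := by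
  have hFc : Continuous F := continuous_iff_continuousAt.2 fun x => (hF x).continuousAt
  have hba : 0 < b - a := sub_pos.2 hab
  have key : ∀ α ∈ Ioo 0 (π / (b - a)),
      α ^ 2 * ∫ x in a..b, F x ^ 2 ≤ ∫ x in a..b, f x ^ 2 := by
    rintro α ⟨hα0, hα⟩
    have hα' : α * (b - a) < π := (lt_div_iff₀ hba).1 hα
    have hcos : ∀ x ∈ Icc a b, cos (α * (x - (a + b) / 2)) ≠ 0 := by
      rintro x ⟨h1, h2⟩
      refine (cos_pos_of_mem_Ioo ⟨?_, ?_⟩).ne' <;> nlinarith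
    set Q : ℝ → ℝ := fun x => -(α * tan (α * (x - (a + b) / 2))) with hQ
    have hQd : ∀ x ∈ Icc a b, HasDerivAt Q (-α ^ 2 - Q x ^ 2) x := by
      intro x hx
      have h1 : HasDerivAt (fun x => α * (x - (a + b) / 2)) (α * 1) x :=
        ((hasDerivAt_id x).sub_const _).const_mul α
      have h2 := (((hasDerivAt_tan (hcos x hx)).comp x h1).const_mul α).neg
      refine h2.congr_deriv ?_
      have := hcos x hx
      have h3 : 1 / cos (α * (x - (a + b) / 2)) ^ 2 = 1 + tan (α * (x - (a + b) / 2)) ^ 2 := by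
        rw [tan_eq_sin_div_cos]
        generalize α * (x - (a + b) / 2) = y at this ⊢
        field_simp
        linarith [sin_sq_add_cos_sq y]
      rw [h3]
      ring
    have hQc : ContinuousOn Q (Icc a b) := fun x hx => (hQd x hx).continuousAt.continuousWithinAt
    have huIcc : uIcc a b = Icc a b := uIcc_of_le hab.le
    have hD : ∀ x ∈ uIcc a b, HasDerivAt (fun x => F x ^ 2 * Q x)
        (f x ^ 2 - α ^ 2 * F x ^ 2 - (f x - F x * Q x) ^ 2) x := by
      intro x hx
      refine (((hF x).pow 2).mul (hQd x (huIcc ▸ hx))).congr_deriv ?_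
      simp only [Pi.pow_apply]; push_cast; ring
    have hi1 : IntervalIntegrable (fun x => f x ^ 2) volume a b :=
      (hf.pow 2).intervalIntegrable _ _
    have hi2 : IntervalIntegrable (fun x => α ^ 2 * F x ^ 2) volume a b :=
      (continuous_const.mul (hFc.pow 2)).intervalIntegrable _ _
    have hi3 : IntervalIntegrable (fun x => (f x - F x * Q x) ^ 2) volume a b := by
      apply ContinuousOn.intervalIntegrable
      rw [huIcc]
      exact (hf.continuousOn.sub (hFc.continuousOn.mul hQc)).pow 2
    have hI := intervalIntegral.integral_eq_sub_of_hasDerivAt hD ((hi1.sub hi2).sub hi3)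
    rw [intervalIntegral.integral_sub (hi1.sub hi2) hi3, intervalIntegral.integral_sub hi1 hi2,
      intervalIntegral.integral_const_mul, ha, hb] at hI
    have h0 : 0 ≤ ∫ x in a..b, (f x - F x * Q x) ^ 2 :=
      intervalIntegral.integral_nonneg hab.le fun x _ => sq_nonneg _
    linarith
  have hlim : Filter.Tendsto (fun α : ℝ => α ^ 2 * ∫ x in a..b, F x ^ 2)
      (nhdsWithin (π / (b - a)) (Iio (π / (b - a))))
      (nhds ((π / (b - a)) ^ 2 * ∫ x in a..b, F x ^ 2)) :=
    (((continuous_id.pow 2).mul continuous_const).tendsto _).mono_left nhdsWithin_le_nhds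
  exact le_of_tendsto hlim (Filter.eventually_of_mem
    (Ioo_mem_nhdsLT (div_pos pi_pos hba)) key)

/-- Wirtinger's inequality for mean-zero functions on an interval (Neumann case). -/
theorem wirtinger_neumann {a b : ℝ} (hab : a < b) {h h' : ℝ → ℝ}
    (hh : ∀ x, HasDerivAt h (h' x) x) (hh' : Continuous h') (hmean : ∫ x in a..b, h x = 0) :
    (π / (b - a)) ^ 2 * ∫ x in a..b, h x ^ 2 ≤ ∫ x in a..b, h' x ^ 2 := by
  have hc : Continuous h := continuous_iff_continuousAt.2 fun x => (hh x).continuousAt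
  set F : ℝ → ℝ := fun x => ∫ y in a..x, h y with hFdef
  have hF : ∀ x, HasDerivAt F (h x) x := fun x => hc.integral_hasStrictDerivAt a x |>.hasDerivAt
  have hFc : Continuous F := continuous_iff_continuousAt.2 fun x => (hF x).continuousAt
  have hFa : F a = 0 := by simp [hFdef]
  have hFb : F b = 0 := hmean
  have hdir := wirtinger_dirichlet hab hF hc hFa hFb
  set l := π / (b - a)
  have hl : 0 < l := div_pos pi_pos (sub_pos.2 hab)
  have hparts : ∫ x in a..b, h x ^ 2 = -∫ x in a..b, F x * h' x := by
    have := intervalIntegral.integral_mul_deriv_eq_deriv_mul (a := a) (b := b)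
      (u := F) (v := h) (u' := h) (v' := h') (fun x _ => hF x) (fun x _ => hh x)
      (hc.intervalIntegrable _ _) (hh'.intervalIntegrable _ _)
    rw [this, hFa, hFb]
    simp [sq]
  have hle : -∫ x in a..b, F x * h' x ≤
      ∫ x in a..b, (l ^ 2 / 2 * F x ^ 2 + 1 / (2 * l ^ 2) * h' x ^ 2) := by
    rw [← intervalIntegral.integral_neg]
    refine intervalIntegral.integral_mono_on hab.le
      ((hFc.mul hh').neg.intervalIntegrable _ _)
      (Continuous.intervalIntegrable (by fun_prop) _ _) ?_
    intro x _
    have : l ^ 2 / 2 * F x ^ 2 + 1 / (2 * l ^ 2) * h' x ^ 2 + F x * h' x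
        = (l * F x + h' x / l) ^ 2 / 2 := by field_simp; ring
    nlinarith [sq_nonneg (l * F x + h' x / l)]
  rw [intervalIntegral.integral_add (Continuous.intervalIntegrable (by fun_prop) _ _)
    (Continuous.intervalIntegrable (by fun_prop) _ _), intervalIntegral.integral_const_mul,
    intervalIntegral.integral_const_mul, ← hparts] at hle
  have h3 : (∫ x in a..b, h x ^ 2) / 2 ≤ 1 / (2 * l ^ 2) * ∫ x in a..b, h' x ^ 2 := by linarith
  have h4 := mul_le_mul_of_nonneg_left h3 (by positivity : 0 ≤ 2 * l ^ 2)
  have h5 : 2 * l ^ 2 * (1 / (2 * l ^ 2) * ∫ x in a..b, h' x ^ 2) = ∫ x in a..b, h' x ^ 2 := by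
    field_simp
  linarith

/-- Wirtinger's inequality for mean-zero functions with matching end values (periodic case). -/
theorem wirtinger_periodic {a b : ℝ} (hab : a < b) {h h' : ℝ → ℝ}
    (hh : ∀ x, HasDerivAt h (h' x) x) (hh' : Continuous h') (hmean : ∫ x in a..b, h x = 0)
    (hper : h a = h b) :
    (2 * π / (b - a)) ^ 2 * ∫ x in a..b, h x ^ 2 ≤ ∫ x in a..b, h' x ^ 2 := by
  have hc : Continuous h := continuous_iff_continuousAt.2 fun x => (hh x).continuousAt
  obtain ⟨c, hcdef⟩ : ∃ c, c = (a + b) / 2 := ⟨_, rfl⟩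
  have hac : a < c := by linarith
  have hfold : ∀ g : ℝ → ℝ, Continuous g →
      ∫ x in a..b, g x = ∫ x in a..c, (g x + g (a + b - x)) := by
    intro g hg
    rw [intervalIntegral.integral_add (hg.intervalIntegrable _ _)
      (Continuous.intervalIntegrable (by fun_prop) _ _),
      intervalIntegral.integral_comp_sub_left (fun x => g x) (a + b),
      show a + b - c = c by linarith, show a + b - a = b by ring,
      intervalIntegral.integral_add_adjacent_intervals (hg.intervalIntegrable _ _)
      (hg.intervalIntegrable _ _)]
  have hrefl : ∀ x, HasDerivAt (fun x => h (a + b - x)) (-h' (a + b - x)) x := by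
    intro x
    have h1 : HasDerivAt (fun x : ℝ => a + b - x) (-1) x := (hasDerivAt_id x).const_sub _
    exact ((hh (a + b - x)).comp x h1).congr_deriv (by ring)
  have he := wirtinger_neumann hac (h := fun x => (h x + h (a + b - x)) / 2)
    (h' := fun x => (h' x + -h' (a + b - x)) / 2)
    (fun x => ((hh x).add (hrefl x)).div_const 2) (by fun_prop)
    (by rw [intervalIntegral.integral_div, ← hfold h hc, hmean, zero_div])
  have ho := wirtinger_dirichlet hac (F := fun x => (h x - h (a + b - x)) / 2)
    (f := fun x => (h' x - -h' (a + b - x)) / 2)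
    (fun x => ((hh x).sub (hrefl x)).div_const 2) (by fun_prop)
    (by simp [hper]) (by simp [show a + b - c = c by linarith])
  have hl : π / (c - a) = 2 * π / (b - a) := by
    rw [hcdef, show (a + b) / 2 - a = (b - a) / 2 by ring]
    field_simp
  rw [hl] at he ho
  have hsum := add_le_add he ho
  rw [← mul_add, ← intervalIntegral.integral_add (Continuous.intervalIntegrable (by fun_prop) _ _)
    (Continuous.intervalIntegrable (by fun_prop) _ _),
    ← intervalIntegral.integral_add (Continuous.intervalIntegrable (by fun_prop) _ _)
    (Continuous.intervalIntegrable (by fun_prop) _ _)] at hsum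
  rw [hfold (fun x => h x ^ 2) (hc.pow 2), hfold (fun x => h' x ^ 2) (hh'.pow 2)]
  have e1 : ∀ g : ℝ → ℝ, (∫ x in a..c, (g x ^ 2 + g (a + b - x) ^ 2)) =
      2 * ∫ x in a..c, (((g x + g (a + b - x)) / 2) ^ 2 + ((g x - g (a + b - x)) / 2) ^ 2) := by
    intro g
    rw [← intervalIntegral.integral_const_mul]
    congr 1; ext x; ring
  rw [e1 h, e1 h']
  have e2 : (∫ x in a..c, (((h' x + -h' (a + b - x)) / 2) ^ 2 +
      ((h' x - -h' (a + b - x)) / 2) ^ 2)) =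
      ∫ x in a..c, (((h' x + h' (a + b - x)) / 2) ^ 2 + ((h' x - h' (a + b - x)) / 2) ^ 2) := by
    congr 1; ext x; ring
  rw [e2] at hsum
  linarith

theorem integral_integral_swap_of_isCompact {X Y : Type*} [TopologicalSpace X] [MeasurableSpace X]
    [BorelSpace X] [SecondCountableTopology X] [T2Space X] [TopologicalSpace Y]
    [MeasurableSpace Y] [BorelSpace Y] [SecondCountableTopology Y] [T2Space Y]
    (μ : Measure X) (ν : Measure Y) [IsLocallyFiniteMeasure μ] [IsLocallyFiniteMeasure ν]
    [SFinite μ] [SFinite ν] {s : Set X} {t : Set Y} (hs : IsCompact s) (ht : IsCompact t)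
    {f : X → Y → ℝ} (hf : Continuous f.uncurry) :
    ∫ x in s, ∫ y in t, f x y ∂ν ∂μ = ∫ y in t, ∫ x in s, f x y ∂μ ∂ν := by
  apply integral_integral_swap
  rw [Measure.prod_restrict]
  exact hf.continuousOn.integrableOn_compact (hs.prod ht)

/-- Subadditivity of the variance over a product, for continuous functions on compact sets. -/
theorem sq_integral_add_sq_integral_le {X Y : Type*} [TopologicalSpace X] [MeasurableSpace X]
    [BorelSpace X] [SecondCountableTopology X] [T2Space X] [LocallyCompactSpace X]
    [TopologicalSpace Y] [MeasurableSpace Y] [BorelSpace Y] [SecondCountableTopology Y]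
    [T2Space Y] [LocallyCompactSpace Y] (μ : Measure X) (ν : Measure Y)
    [IsLocallyFiniteMeasure μ] [IsLocallyFiniteMeasure ν] [SFinite μ] [SFinite ν]
    {s : Set X} {t : Set Y} (hs : IsCompact s) (ht : IsCompact t)
    (hμ : 0 < μ.real s) (hν : 0 < ν.real t) {f : X → Y → ℝ} (hf : Continuous f.uncurry) :
    (∫ x in s, (∫ y in t, f x y ∂ν) ^ 2 ∂μ) / ν.real t +
        (∫ y in t, (∫ x in s, f x y ∂μ) ^ 2 ∂ν) / μ.real s ≤
      (∫ x in s, ∫ y in t, f x y ^ 2 ∂ν ∂μ) +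
        (∫ x in s, ∫ y in t, f x y ∂ν ∂μ) ^ 2 / (μ.real s * ν.real t) := by
  set S := μ.real s with hS
  set T := ν.real t with hT
  obtain ⟨a, ha⟩ : ∃ a : X → ℝ, a = fun x => ∫ y in t, f x y ∂ν := ⟨_, rfl⟩
  obtain ⟨b, hb⟩ : ∃ b : Y → ℝ, b = fun y => ∫ x in s, f x y ∂μ := ⟨_, rfl⟩
  have hfc : Continuous fun p : X × Y => f p.1 p.2 := hf
  have hac : Continuous a := ha ▸ continuous_parametric_integral_of_continuous hf ht
  have hbc : Continuous b := by
    rw [hb]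
    exact continuous_parametric_integral_of_continuous (f := fun y x => f x y)
      (hfc.comp continuous_swap) hs
  obtain ⟨m, hm⟩ : ∃ m, m = ∫ x in s, a x ∂μ := ⟨_, rfl⟩
  have hmb : ∫ y in t, b y ∂ν = m := by
    rw [hm, ha, hb]; exact (integral_integral_swap_of_isCompact μ ν hs ht hf).symm
  have hfb : ∫ x in s, ∫ y in t, f x y * b y ∂ν ∂μ = ∫ y in t, b y ^ 2 ∂ν := by
    rw [integral_integral_swap_of_isCompact μ ν hs ht (f := fun x y => f x y * b y)
      (hfc.mul (hbc.comp continuous_snd))]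
    congr 1; ext y
    rw [integral_mul_const, sq]
    simp only [hb]
  have iX : ∀ {g : X → ℝ}, Continuous g → Integrable g (μ.restrict s) := fun hg =>
    hg.continuousOn.integrableOn_compact hs
  have iY : ∀ {g : Y → ℝ}, Continuous g → Integrable g (ν.restrict t) := fun hg =>
    hg.continuousOn.integrableOn_compact ht
  have hfx : ∀ x, Continuous (f x) := fun x => hfc.comp (Continuous.prodMk_right x)
  have hinner : ∀ x, ∫ y in t, (f x y - b y / S + (m / (S * T) - a x / T)) ^ 2 ∂ν =
      (∫ y in t, f x y ^ 2 ∂ν) + (∫ y in t, b y ^ 2 ∂ν) / S ^ 2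
        - 2 / S * (∫ y in t, f x y * b y ∂ν) + T * (m / (S * T) - a x / T) ^ 2
        + 2 * (m / (S * T) - a x / T) * a x - 2 * (m / (S * T) - a x / T) * (m / S) := by
    intro x
    obtain ⟨α, hα⟩ : ∃ α, α = m / (S * T) - a x / T := ⟨_, rfl⟩
    rw [← hα]
    have hc := hfx x
    have e : (fun y => (f x y - b y / S + α) ^ 2) = fun y =>
        (f x y ^ 2 + (1 / S ^ 2) * b y ^ 2 - 2 / S * (f x y * b y) + α ^ 2 + 2 * α * f x y)
          - 2 * α / S * b y := by
      ext y; ring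
    rw [e, integral_sub (iY (by fun_prop)) (iY (by fun_prop)),
      integral_add (iY (by fun_prop)) (iY (by fun_prop)),
      integral_add (iY (by fun_prop)) (iY (by fun_prop)),
      integral_sub (iY (by fun_prop)) (iY (by fun_prop)),
      integral_add (iY (by fun_prop)) (iY (by fun_prop))]
    simp only [integral_const_mul, integral_const, smul_eq_mul, hmb,
      measureReal_restrict_apply_univ]
    rw [← hT]
    have : ∫ y in t, f x y ∂ν = a x := by rw [ha]
    rw [this]; ring
  have hnn : 0 ≤ ∫ x in s, ∫ y in t, (f x y - b y / S + (m / (S * T) - a x / T)) ^ 2 ∂ν ∂μ :=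
    integral_nonneg fun x => integral_nonneg fun y => sq_nonneg _
  have c1 : Continuous fun x => ∫ y in t, f x y ^ 2 ∂ν :=
    continuous_parametric_integral_of_continuous (f := fun x y => f x y ^ 2)
      (show Continuous fun p : X × Y => f p.1 p.2 ^ 2 by fun_prop) ht
  have c2 : Continuous fun x => ∫ y in t, f x y * b y ∂ν :=
    continuous_parametric_integral_of_continuous (f := fun x y => f x y * b y)
      (hfc.mul (hbc.comp continuous_snd)) ht
  have e : (fun x => ∫ y in t, (f x y - b y / S + (m / (S * T) - a x / T)) ^ 2 ∂ν) = fun x =>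
      (∫ y in t, f x y ^ 2 ∂ν) - 2 / S * (∫ y in t, f x y * b y ∂ν) - 1 / T * a x ^ 2
        + 2 * m / (S * T) * a x
        + ((∫ y in t, b y ^ 2 ∂ν) / S ^ 2 - m ^ 2 / (S ^ 2 * T)) := by
    ext x; rw [hinner]; field_simp; ring
  rw [e, integral_add (iX (by fun_prop)) (iX (by fun_prop)),
    integral_add (iX (by fun_prop)) (iX (by fun_prop)),
    integral_sub (iX (by fun_prop)) (iX (by fun_prop)),
    integral_sub (iX (by fun_prop)) (iX (by fun_prop))] at hnn
  simp only [integral_const_mul, integral_const, smul_eq_mul, hfb, measureReal_restrict_apply_univ,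
    ← hm, ← hS] at hnn
  have g1 : ∫ x in s, (∫ y in t, f x y ∂ν) ^ 2 ∂μ = ∫ x in s, a x ^ 2 ∂μ := by rw [ha]
  have g2 : ∫ y in t, (∫ x in s, f x y ∂μ) ^ 2 ∂ν = ∫ y in t, b y ^ 2 ∂ν := by rw [hb]
  have g3 : ∫ x in s, ∫ y in t, f x y ∂ν ∂μ = m := by rw [hm, ha]
  rw [g1, g2, g3]
  generalize (∫ x in s, a x ^ 2 ∂μ) = p at *
  generalize (∫ y in t, b y ^ 2 ∂ν) = q at *
  generalize (∫ x in s, ∫ y in t, f x y ^ 2 ∂ν ∂μ) = r at *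
  have : r - 2 / S * q - 1 / T * p + 2 * m / (S * T) * m + S * (q / S ^ 2 - m ^ 2 / (S ^ 2 * T))
      = r + m ^ 2 / (S * T) - (p / T + q / S) := by
    field_simp; ring
  linarith

theorem setIntegral_Icc_fin_cons {n : ℕ} (a b : Fin (n + 1) → ℝ) {f : (Fin (n + 1) → ℝ) → ℝ}
    (hf : Continuous f) :
    ∫ x in Icc a b, f x = ∫ s in Icc (a 0) (b 0), ∫ x in Icc (Fin.tail a) (Fin.tail b),
      f (Fin.cons s x) := by
  have hmp := (volume_preserving_piFinSuccAbove (fun _ : Fin (n + 1) => ℝ) 0).symm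
  rw [← hmp.setIntegral_preimage_emb (MeasurableEquiv.measurableEmbedding _)]
  have hpre : (MeasurableEquiv.piFinSuccAbove (fun _ : Fin (n + 1) => ℝ) 0).symm ⁻¹' Icc a b =
      Icc (a 0) (b 0) ×ˢ Icc (Fin.tail a) (Fin.tail b) := by
    ext ⟨s, x⟩
    simp [MeasurableEquiv.piFinSuccAbove_symm_apply, Pi.le_def, Fin.forall_fin_succ, Fin.tail]
  rw [hpre]
  have hcons : Continuous fun p : ℝ × (Fin n → ℝ) => f (Fin.cons p.1 p.2) :=
    hf.comp (Continuous.finCons continuous_fst continuous_snd)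
  rw [Measure.volume_eq_prod, setIntegral_prod]
  · simp [MeasurableEquiv.piFinSuccAbove_symm_apply, Fin.consEquiv]
  · simpa [MeasurableEquiv.piFinSuccAbove_symm_apply, Fin.consEquiv] using
      hcons.continuousOn.integrableOn_compact (isCompact_Icc.prod isCompact_Icc)

theorem mul_integral_sub_div_le {X : Type*} [MeasurableSpace X] {μ : Measure X} {P Q R : X → ℝ}
    {c T : ℝ} (hP : Integrable P μ) (hQ : Integrable Q μ) (hR : Integrable R μ)
    (h : ∀ x, c * (P x - Q x / T) ≤ R x) :
    c * ((∫ x, P x ∂μ) - (∫ x, Q x ∂μ) / T) ≤ ∫ x, R x ∂μ := by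
  rw [← integral_div, ← integral_sub hP (hQ.div_const T), ← integral_const_mul]
  exact integral_mono ((hP.sub (hQ.div_const T)).const_mul c) hR h

/-- One-dimensional Poincaré inequalities along every coordinate line of a box give the Poincaré
inequality on the box with the same constant. -/
theorem poincare_box {n : ℕ} (a b : Fin n → ℝ) (hab : ∀ i, a i < b i) {c : ℝ} (hc : 0 ≤ c)
    {f : (Fin n → ℝ) → ℝ} {g : Fin n → (Fin n → ℝ) → ℝ} (hf : Continuous f)
    (hg : ∀ i, Continuous (g i))
    (hline : ∀ i x, c * ((∫ s in Icc (a i) (b i), f (Function.update x i s) ^ 2) -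
      (∫ s in Icc (a i) (b i), f (Function.update x i s)) ^ 2 / (b i - a i)) ≤
        ∫ s in Icc (a i) (b i), g i (Function.update x i s)) :
    c * ((∫ x in Icc a b, f x ^ 2) - (∫ x in Icc a b, f x) ^ 2 / ∏ i, (b i - a i)) ≤
      ∫ x in Icc a b, ∑ i, g i x := by
  induction n with
  | zero =>
    have h1 : (volume ({0} : Set (Fin 0 → ℝ))).toReal = 1 := by
      simp [volume_pi, Measure.pi_of_empty _ (0 : Fin 0 → ℝ)]
    simp [Subsingleton.elim a b, integral_unique, measureReal_def, h1]
  | succ n ih =>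
    have hcons : Continuous fun p : ℝ × (Fin n → ℝ) => (Fin.cons p.1 p.2 : Fin (n + 1) → ℝ) :=
      Continuous.finCons continuous_fst continuous_snd
    have hfc : Continuous (Function.uncurry fun s x => f (Fin.cons s x : Fin (n + 1) → ℝ)) :=
      hf.comp hcons
    have hgc : ∀ i, Continuous fun p : ℝ × (Fin n → ℝ) => g i (Fin.cons p.1 p.2) :=
      fun i => (hg i).comp hcons
    set a' := Fin.tail a
    set b' := Fin.tail b
    have hS : volume.real (Icc (a 0) (b 0)) = b 0 - a 0 := by
      simp [measureReal_def, (hab 0).le]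
    have hab' : a' ≤ b' := fun i => (hab (Fin.succ i)).le
    have hT : volume.real (Icc a' b') = ∏ i, (b' i - a' i) := by
      rw [measureReal_def, Real.volume_Icc_pi_toReal hab']
    have hSpos : 0 < b 0 - a 0 := sub_pos.2 (hab 0)
    have hTpos : 0 < ∏ i, (b' i - a' i) := Finset.prod_pos fun i _ => sub_pos.2 (hab i.succ)
    have hten := sq_integral_add_sq_integral_le volume volume
      (isCompact_Icc (a := a 0) (b := b 0)) (isCompact_Icc (a := a') (b := b'))
      (hS ▸ hSpos) (hT ▸ hTpos) hfc
    rw [hS, hT] at hten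
    rw [setIntegral_Icc_fin_cons a b hf,
      setIntegral_Icc_fin_cons a b (f := fun x => f x ^ 2) (hf.pow 2),
      setIntegral_Icc_fin_cons a b (continuous_finsetSum _ fun i _ => hg i), Fin.prod_univ_succ]
    have h0 : ∀ x : Fin n → ℝ, c * ((∫ s in Icc (a 0) (b 0), f (Fin.cons s x) ^ 2) -
        (∫ s in Icc (a 0) (b 0), f (Fin.cons s x)) ^ 2 / (b 0 - a 0)) ≤
        ∫ s in Icc (a 0) (b 0), g 0 (Fin.cons s x) := by
      intro x
      simpa [Fin.update_cons_zero] using hline 0 (Fin.cons 0 x)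
    have hs : ∀ s : ℝ, c * ((∫ x in Icc a' b', f (Fin.cons s x) ^ 2) -
        (∫ x in Icc a' b', f (Fin.cons s x)) ^ 2 / ∏ i, (b' i - a' i)) ≤
        ∫ x in Icc a' b', ∑ i : Fin n, g i.succ (Fin.cons s x) := by
      intro s
      refine ih a' b' (fun i => hab i.succ) (hfc.comp (Continuous.prodMk_right s))
        (g := fun i x => g i.succ (Fin.cons s x))
        (fun i => (hgc i.succ).comp (Continuous.prodMk_right s)) ?_
      intro i x
      simpa [Fin.cons_update, a', b', Fin.tail] using hline i.succ (Fin.cons s x)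
    have i1 : ∀ {h : ℝ → ℝ}, Continuous h → IntegrableOn h (Icc (a 0) (b 0)) := fun h =>
      h.continuousOn.integrableOn_compact isCompact_Icc
    have i2 : ∀ {h : (Fin n → ℝ) → ℝ}, Continuous h → IntegrableOn h (Icc a' b') := fun h =>
      h.continuousOn.integrableOn_compact isCompact_Icc
    have p1 : ∀ {h : (Fin (n + 1) → ℝ) → ℝ}, Continuous h →
        Continuous fun s : ℝ => ∫ x in Icc a' b', h (Fin.cons s x) := fun {h} hh =>
      continuous_parametric_integral_of_continuous
        (f := fun s (x : Fin n → ℝ) => h (Fin.cons s x)) (hh.comp hcons) isCompact_Icc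
    have p2 : ∀ {h : (Fin (n + 1) → ℝ) → ℝ}, Continuous h →
        Continuous fun x : Fin n → ℝ => ∫ s in Icc (a 0) (b 0), h (Fin.cons s x) := fun {h} hh =>
      continuous_parametric_integral_of_continuous
        (f := fun (x : Fin n → ℝ) s => h (Fin.cons s x))
        ((hh.comp hcons).comp continuous_swap) isCompact_Icc
    have hf2 : Continuous fun x => f x ^ 2 := hf.pow 2
    have hgs : Continuous fun x => ∑ i : Fin n, g i.succ x :=
      continuous_finsetSum _ fun i _ => hg i.succ
    have I0 := mul_integral_sub_div_le (i2 (p2 hf2)) (i2 ((p2 hf).pow 2)) (i2 (p2 (hg 0))) h0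
    have Is := mul_integral_sub_div_le (i1 (p1 hf2)) (i1 ((p1 hf).pow 2)) (i1 (p1 hgs)) hs
    have sw : ∀ {h : (Fin (n + 1) → ℝ) → ℝ}, Continuous h →
        ∫ x in Icc a' b', ∫ s in Icc (a 0) (b 0), h (Fin.cons s x) =
        ∫ s in Icc (a 0) (b 0), ∫ x in Icc a' b', h (Fin.cons s x) := fun {h} hh =>
      (integral_integral_swap_of_isCompact volume volume isCompact_Icc isCompact_Icc
        (f := fun s (x : Fin n → ℝ) => h (Fin.cons s x)) (hh.comp hcons)).symm
    rw [sw hf2, sw (hg 0)] at I0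
    have hsum : ∫ s in Icc (a 0) (b 0), ∫ x in Icc a' b', ∑ i, g i (Fin.cons s x) =
        (∫ s in Icc (a 0) (b 0), ∫ x in Icc a' b', g 0 (Fin.cons s x)) +
        ∫ s in Icc (a 0) (b 0), ∫ x in Icc a' b', ∑ i : Fin n, g i.succ (Fin.cons s x) := by
      rw [← integral_add (i1 (p1 (hg 0))) (i1 (p1 hgs))]
      congr 1; ext s
      simp only [Fin.sum_univ_succ]
      exact integral_add (i2 ((hgc 0).comp (Continuous.prodMk_right s)))
        (i2 ((hgs.comp hcons).comp (Continuous.prodMk_right s)))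
    have hmul := mul_le_mul_of_nonneg_left hten hc
    change c * (_ - _ / ((b 0 - a 0) * ∏ i, (b' i - a' i))) ≤ _
    rw [hsum]
    simp only [Pi.pow_apply] at I0 Is
    linarith

theorem mul_variance_Icc_le {a b c C : ℝ} (hab : a < b) (hcC : c ≤ C) {h h' : ℝ → ℝ}
    (hc : Continuous h)
    (hW : C * ∫ x in a..b, (h x - (∫ y in a..b, h y) / (b - a)) ^ 2 ≤ ∫ x in a..b, h' x ^ 2) :
    c * ((∫ x in Icc a b, h x ^ 2) - (∫ x in Icc a b, h x) ^ 2 / (b - a)) ≤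
      ∫ x in Icc a b, h' x ^ 2 := by
  simp only [integral_Icc_eq_integral_Ioc, ← intervalIntegral.integral_of_le hab.le]
  have hba : b - a ≠ 0 := (sub_pos.2 hab).ne'
  obtain ⟨m, hm⟩ : ∃ m, m = ∫ y in a..b, h y := ⟨_, rfl⟩
  rw [← hm] at hW ⊢
  have hexp : ∫ x in a..b, (h x - m / (b - a)) ^ 2 = (∫ x in a..b, h x ^ 2) - m ^ 2 / (b - a) := by
    have e : (fun x => (h x - m / (b - a)) ^ 2) = fun x =>
        h x ^ 2 - 2 * (m / (b - a)) * h x + (m / (b - a)) ^ 2 := by ext x; ring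
    rw [e, intervalIntegral.integral_add (Continuous.intervalIntegrable (by fun_prop) _ _)
      (Continuous.intervalIntegrable (by fun_prop) _ _),
      intervalIntegral.integral_sub (Continuous.intervalIntegrable (by fun_prop) _ _)
      (Continuous.intervalIntegrable (by fun_prop) _ _), intervalIntegral.integral_const_mul,
      intervalIntegral.integral_const, ← hm, smul_eq_mul]
    field_simp
    ring
  have h0 : 0 ≤ ∫ x in a..b, (h x - m / (b - a)) ^ 2 :=
    intervalIntegral.integral_nonneg hab.le fun x _ => sq_nonneg _
  rw [← hexp]
  exact (mul_le_mul_of_nonneg_right hcC h0).trans hW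

theorem integral_sub_mean_eq_zero {a b : ℝ} (hab : a < b) {h : ℝ → ℝ} (hc : Continuous h) :
    ∫ x in a..b, (h x - (∫ y in a..b, h y) / (b - a)) = 0 := by
  have hba : b - a ≠ 0 := (sub_pos.2 hab).ne'
  rw [intervalIntegral.integral_sub (hc.intervalIntegrable _ _)
    (Continuous.intervalIntegrable (by fun_prop) _ _), intervalIntegral.integral_const, smul_eq_mul]
  field_simp
  ring

theorem slab_eq_pi_Ioo (L₁ L₂ d : ℝ) :
    slab L₁ L₂ d = Set.univ.pi fun i => Ioo ((![0, 0, -d] : Fin 3 → ℝ) i) (![L₁, L₂, 0] i) := by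
  unfold slab
  congr 1
  funext i
  fin_cases i <;> rfl

theorem measurableSet_slab (L₁ L₂ d : ℝ) : MeasurableSet (slab L₁ L₂ d) := by
  rw [slab_eq_pi_Ioo]
  exact MeasurableSet.univ_pi fun i => measurableSet_Ioo

theorem slab_ae_eq_Icc (L₁ L₂ d : ℝ) :
    slab L₁ L₂ d =ᵐ[volume] Icc (![0, 0, -d] : Fin 3 → ℝ) ![L₁, L₂, 0] := by
  rw [slab_eq_pi_Ioo]
  exact Measure.univ_pi_Ioo_ae_eq_Icc

theorem slab_subset_Icc (L₁ L₂ d : ℝ) :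
    slab L₁ L₂ d ⊆ Icc (![0, 0, -d] : Fin 3 → ℝ) ![L₁, L₂, 0] := by
  rw [slab_eq_pi_Ioo]
  exact fun x hx => ⟨fun i => (hx i trivial).1.le, fun i => (hx i trivial).2.le⟩

theorem Continuous.integrableOn_slab {L₁ L₂ d : ℝ} {f : (Fin 3 → ℝ) → ℝ} (hf : Continuous f) :
    IntegrableOn f (slab L₁ L₂ d) :=
  (hf.continuousOn.integrableOn_compact isCompact_Icc).mono_set (slab_subset_Icc L₁ L₂ d)

theorem volume_slab {L₁ L₂ d : ℝ} (hd : 0 < d) (hL₁ : 0 < L₁) (hL₂ : 0 < L₂) :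
    volume.real (slab L₁ L₂ d) = L₁ * L₂ * d := by
  rw [slab_eq_pi_Ioo, measureReal_def, Real.volume_pi_Ioo_toReal]
  · simp [Fin.prod_univ_three]
  · intro i
    fin_cases i <;> simp [hd.le, hL₁.le, hL₂.le]

theorem continuous_pd {f : (Fin 3 → ℝ) → ℝ} (hf : ContDiff ℝ 1 f) (i : Fin 3) :
    Continuous (pd i f) :=
  (hf.continuous_fderiv one_ne_zero).clm_apply continuous_const

/-- Sharp Poincaré inequality on the horizontally periodic slab. -/
theorem slab_poincare {L₁ L₂ d : ℝ} (hd : 0 < d) (hL₁ : 0 < L₁) (hL₂ : 0 < L₂)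
    {f : (Fin 3 → ℝ) → ℝ} (hf : ContDiff ℝ 1 f)
    (hper1 : ∀ x, f (x + Pi.single 0 L₁) = f x) (hper2 : ∀ x, f (x + Pi.single 1 L₂) = f x) :
    π ^ 2 * min (1 / d ^ 2) (min (4 / L₁ ^ 2) (4 / L₂ ^ 2)) *
      ((∫ x in slab L₁ L₂ d, f x ^ 2) - (∫ x in slab L₁ L₂ d, f x) ^ 2 / (L₁ * L₂ * d)) ≤
      ∫ x in slab L₁ L₂ d, ∑ i, pd i f x ^ 2 := by
  have hline : ∀ i x s, HasDerivAt (fun s => f (Function.update x i s))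
      (pd i f (Function.update x i s)) s := fun i x s =>
    ((hf.differentiable one_ne_zero _).hasFDerivAt).comp_hasDerivAt s (hasDerivAt_update x i s)
  have hfc := hf.continuous
  have hupd : ∀ i (x : Fin 3 → ℝ), Continuous fun s => Function.update x i s :=
    fun i x => continuous_const.update i continuous_id
  have hmin : 0 ≤ min (1 / d ^ 2) (min (4 / L₁ ^ 2) (4 / L₂ ^ 2)) := by positivity
  have hpi := sq_nonneg π
  have hperiodic : ∀ (i : Fin 3) (L : ℝ), 0 < L → (∀ x, f (x + Pi.single i L) = f x) →
      min (1 / d ^ 2) (min (4 / L₁ ^ 2) (4 / L₂ ^ 2)) ≤ 4 / L ^ 2 → ∀ x : Fin 3 → ℝ,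
      π ^ 2 * min (1 / d ^ 2) (min (4 / L₁ ^ 2) (4 / L₂ ^ 2)) *
      ((∫ s in Icc 0 L, f (Function.update x i s) ^ 2) -
      (∫ s in Icc 0 L, f (Function.update x i s)) ^ 2 / (L - 0)) ≤
        ∫ s in Icc 0 L, pd i f (Function.update x i s) ^ 2 := by
    intro i L hL hper hle x
    have hC : π ^ 2 * min (1 / d ^ 2) (min (4 / L₁ ^ 2) (4 / L₂ ^ 2)) ≤
        (2 * π / (L - 0)) ^ 2 := by
      refine (mul_le_mul_of_nonneg_left hle hpi).trans_eq ?_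
      rw [sub_zero]; ring
    refine mul_variance_Icc_le hL hC (hfc.comp (hupd i x)) ?_
    refine wirtinger_periodic hL (fun s => (hline i x s).sub_const _)
      ((continuous_pd hf i).comp (hupd i x))
      (integral_sub_mean_eq_zero hL (hfc.comp (hupd i x))) ?_
    congr 1
    rw [← hper]
    congr 1
    ext j
    by_cases hj : j = i
    · subst hj; simp
    · simp [hj]
  have hbox := poincare_box ![0, 0, -d] ![L₁, L₂, 0]
    (by intro i; fin_cases i <;> simp [hd, hL₁, hL₂]) (mul_nonneg hpi hmin) hfc
    (g := fun i x => pd i f x ^ 2) (fun i => (continuous_pd hf i).pow 2) (by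
      intro i x
      fin_cases i
      · exact hperiodic 0 L₁ hL₁ hper1 ((min_le_right _ _).trans (min_le_left _ _)) x
      · exact hperiodic 1 L₂ hL₂ hper2 ((min_le_right _ _).trans (min_le_right _ _)) x
      · have hd' : -d < 0 := neg_neg_of_pos hd
        have hC : π ^ 2 * min (1 / d ^ 2) (min (4 / L₁ ^ 2) (4 / L₂ ^ 2)) ≤
            (π / (0 - -d)) ^ 2 := by
          refine (mul_le_mul_of_nonneg_left (min_le_left _ _) hpi).trans_eq ?_
          rw [zero_sub, neg_neg]; ring
        refine mul_variance_Icc_le hd' hC (hfc.comp (hupd 2 x)) ?_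
        exact wirtinger_neumann hd' (fun s => (hline 2 x s).sub_const _)
          ((continuous_pd hf 2).comp (hupd 2 x))
          (integral_sub_mean_eq_zero hd' (hfc.comp (hupd 2 x))))
  simp only [← setIntegral_congr_set (slab_ae_eq_Icc L₁ L₂ d)] at hbox
  simpa [Fin.prod_univ_three] using hbox

/-- The divergence theorem on the periodic slab for fields with vanishing vertical boundary flux. -/
theorem integral_slab_div_eq_zero {L₁ L₂ d : ℝ} (hd : 0 < d) (hL₁ : 0 < L₁) (hL₂ : 0 < L₂)
    {F : Fin 3 → (Fin 3 → ℝ) → ℝ} (hF : ∀ i, ContDiff ℝ 1 (F i))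
    (hper1 : ∀ x, F 0 (x + Pi.single 0 L₁) = F 0 x)
    (hper2 : ∀ x, F 1 (x + Pi.single 1 L₂) = F 1 x)
    (htop : ∀ x : Fin 3 → ℝ, x 2 = 0 → F 2 x = 0)
    (hbot : ∀ x : Fin 3 → ℝ, x 2 = -d → F 2 x = 0) :
    ∫ x in slab L₁ L₂ d, ∑ i, pd i (F i) x = 0 := by
  have hle : (![0, 0, -d] : Fin 3 → ℝ) ≤ ![L₁, L₂, 0] := by
    intro i; fin_cases i <;> simp [hd.le, hL₁.le, hL₂.le]
  have hdiv := integral_divergence_of_hasFDerivAt_off_countable' _ _ hle F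
    (fun i x => fderiv ℝ (F i) x) ∅ countable_empty (fun i => (hF i).continuous.continuousOn)
    (fun x _ i => ((hF i).differentiable one_ne_zero x).hasFDerivAt)
    ((continuous_finsetSum _ fun i _ => continuous_pd (hF i) i).continuousOn.integrableOn_compact
      isCompact_Icc)
  rw [setIntegral_congr_set (slab_ae_eq_Icc L₁ L₂ d)]
  refine hdiv.trans (Finset.sum_eq_zero fun i _ => ?_)
  have hins : ∀ (i : Fin 3) (L : ℝ) (y : Fin 2 → ℝ), (i.insertNth L y : Fin 3 → ℝ) =
      (i.insertNth 0 y : Fin 3 → ℝ) + Pi.single i L := by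
    intro i L y
    ext j
    refine Fin.succAboveCases i ?_ (fun j => ?_) j
    · simp
    · simp
  rw [sub_eq_zero]
  fin_cases i
  · refine congrArg _ (funext fun y => ?_)
    exact (congrArg (F 0) (hins 0 L₁ y)).trans (hper1 _)
  · refine congrArg _ (funext fun y => ?_)
    exact (congrArg (F 1) (hins 1 L₂ y)).trans (hper2 _)
  · refine congrArg _ (funext fun y => ?_)
    exact (htop _ (Fin.insertNth_apply_same (α := fun _ => ℝ) 2 0 y)).trans
      (hbot _ (Fin.insertNth_apply_same (α := fun _ => ℝ) 2 (-d) y)).symm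

theorem hasDerivAt_time {H : ℝ → (Fin 3 → ℝ) → ℝ}
    (hH : ContDiff ℝ 1 fun q : ℝ × (Fin 3 → ℝ) => H q.1 q.2) (t : ℝ) (x : Fin 3 → ℝ) :
    HasDerivAt (fun s => H s x)
      (fderiv ℝ (fun q : ℝ × (Fin 3 → ℝ) => H q.1 q.2) (t, x) (1, 0)) t :=
  HasFDerivAt.comp_hasDerivAt (f := fun s : ℝ => (s, x)) t
    (hH.differentiable one_ne_zero (t, x)).hasFDerivAt
    ((hasDerivAt_id t).prodMk (hasDerivAt_const t x))

theorem hasDerivAt_integral_slab {L₁ L₂ d : ℝ} {H : ℝ → (Fin 3 → ℝ) → ℝ}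
    (hH : ContDiff ℝ 1 fun q : ℝ × (Fin 3 → ℝ) => H q.1 q.2) (t : ℝ) :
    HasDerivAt (fun s => ∫ x in slab L₁ L₂ d, H s x)
      (∫ x in slab L₁ L₂ d, deriv (fun s => H s x) t) t := by
  set D : ℝ × (Fin 3 → ℝ) → ℝ := fun q =>
    fderiv ℝ (fun q : ℝ × (Fin 3 → ℝ) => H q.1 q.2) q (1, 0)
  have hD : Continuous D := (hH.continuous_fderiv one_ne_zero).clm_apply continuous_const
  have hcs : ∀ s, Continuous (H s) := fun s => hH.continuous.comp (Continuous.prodMk_right s)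
  obtain ⟨C, hC⟩ := ((isCompact_Icc (a := t - 1) (b := t + 1)).prod
    (isCompact_Icc (a := (![0, 0, -d] : Fin 3 → ℝ)) (b := ![L₁, L₂, 0]))
    ).exists_bound_of_continuousOn
    hD.continuousOn
  have hfin : volume (slab L₁ L₂ d) ≠ ⊤ :=
    ((measure_mono (slab_subset_Icc L₁ L₂ d)).trans_lt isCompact_Icc.measure_lt_top).ne
  have := (hasDerivAt_integral_of_dominated_loc_of_deriv_le
    (μ := volume.restrict (slab L₁ L₂ d)) (F := H) (F' := fun s x => D (s, x)) (x₀ := t)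
    (s := Icc (t - 1) (t + 1)) (bound := fun _ => C)
    (Icc_mem_nhds (by linarith) (by linarith))
    (Filter.Eventually.of_forall fun s => (hcs s).aestronglyMeasurable)
    (hcs t).integrableOn_slab (hD.comp (Continuous.prodMk_right t)).aestronglyMeasurable
    ((ae_restrict_iff' (measurableSet_slab L₁ L₂ d)).2 (Filter.Eventually.of_forall
      fun x hx s hs => hC (s, x) ⟨hs, slab_subset_Icc L₁ L₂ d hx⟩))
    (integrableOn_const hfin)
    (Filter.Eventually.of_forall fun x s _ => hasDerivAt_time hH s x)).2
  refine this.congr_deriv ?_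
  congr 1
  ext x
  exact (hasDerivAt_time hH t x).deriv.symm

/-- Integrated balance law: the flux drops out and only the source contributes. -/
theorem hasDerivAt_integral_slab_of_balance {L₁ L₂ d : ℝ} (hd : 0 < d) (hL₁ : 0 < L₁)
    (hL₂ : 0 < L₂) {H : ℝ → (Fin 3 → ℝ) → ℝ}
    (hH : ContDiff ℝ 1 fun q : ℝ × (Fin 3 → ℝ) => H q.1 q.2) {t : ℝ}
    {F : Fin 3 → (Fin 3 → ℝ) → ℝ} {R : (Fin 3 → ℝ) → ℝ} (hF : ∀ i, ContDiff ℝ 1 (F i))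
    (hR : Continuous R)
    (hper1 : ∀ x, F 0 (x + Pi.single 0 L₁) = F 0 x)
    (hper2 : ∀ x, F 1 (x + Pi.single 1 L₂) = F 1 x)
    (htop : ∀ x : Fin 3 → ℝ, x 2 = 0 → F 2 x = 0)
    (hbot : ∀ x : Fin 3 → ℝ, x 2 = -d → F 2 x = 0)
    (hbal : ∀ x ∈ slab L₁ L₂ d, deriv (fun s => H s x) t = (∑ i, pd i (F i) x) + R x) :
    HasDerivAt (fun s => ∫ x in slab L₁ L₂ d, H s x) (∫ x in slab L₁ L₂ d, R x) t := by
  refine (hasDerivAt_integral_slab hH t).congr_deriv ?_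
  rw [setIntegral_congr_fun (measurableSet_slab L₁ L₂ d) hbal,
    integral_add (continuous_finsetSum _ fun i _ => continuous_pd (hF i) i).integrableOn_slab
      hR.integrableOn_slab, integral_slab_div_eq_zero hd hL₁ hL₂ hF hper1 hper2 htop hbot, zero_add]

theorem pd_add {f g : (Fin 3 → ℝ) → ℝ} {i : Fin 3} {x : Fin 3 → ℝ} (hf : Differentiable ℝ f)
    (hg : Differentiable ℝ g) : pd i (fun y => f y + g y) x = pd i f x + pd i g x := by
  simp only [pd, fderiv_fun_add (hf x) (hg x), add_apply]

theorem pd_sub {f g : (Fin 3 → ℝ) → ℝ} {i : Fin 3} {x : Fin 3 → ℝ} (hf : Differentiable ℝ f)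
    (hg : Differentiable ℝ g) : pd i (fun y => f y - g y) x = pd i f x - pd i g x := by
  simp only [pd, fderiv_fun_sub (hf x) (hg x), sub_apply]

theorem pd_mul {f g : (Fin 3 → ℝ) → ℝ} {i : Fin 3} {x : Fin 3 → ℝ} (hf : Differentiable ℝ f)
    (hg : Differentiable ℝ g) :
    pd i (fun y => f y * g y) x = f x * pd i g x + g x * pd i f x := by
  simp only [pd, fderiv_fun_mul (hf x) (hg x), add_apply,
    smul_apply, smul_eq_mul]

theorem pd_const (c : ℝ) (i : Fin 3) (x : Fin 3 → ℝ) : pd i (fun _ => c) x = 0 := by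
  simp [pd]

theorem pd_add_right {f : (Fin 3 → ℝ) → ℝ} {v : Fin 3 → ℝ} (hf : ∀ x, f (x + v) = f x)
    (i : Fin 3) (x : Fin 3 → ℝ) : pd i f (x + v) = pd i f x := by
  unfold pd
  rw [← fderiv_comp_add_right, funext hf]

theorem fderiv_fderiv_apply_comm {E : Type*} [NormedAddCommGroup E] [NormedSpace ℝ E] {f : E → ℝ}
    (hf : ContDiff ℝ 2 f) (x v w : E) :
    fderiv ℝ (fun y => fderiv ℝ f y v) x w = fderiv ℝ (fun y => fderiv ℝ f y w) x v := by
  have hd : DifferentiableAt ℝ (fderiv ℝ f) x :=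
    (hf.fderiv_right (m := 1) (by norm_num)).differentiable one_ne_zero x
  have h : ∀ v w, fderiv ℝ (fun y => fderiv ℝ f y v) x w = fderiv ℝ (fderiv ℝ f) x w v := by
    intro v w
    rw [fderiv_clm_apply hd (differentiableAt_const v)]
    simp
  rw [h, h]
  exact (hf.contDiffAt.isSymmSndFDerivAt (by simp)) w v

theorem pd_eq_fderiv_uncurry {H : ℝ → (Fin 3 → ℝ) → ℝ}
    (hH : ContDiff ℝ 1 fun q : ℝ × (Fin 3 → ℝ) => H q.1 q.2) (i : Fin 3) (t : ℝ)
    (x : Fin 3 → ℝ) :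
    pd i (H t) x =
      fderiv ℝ (fun q : ℝ × (Fin 3 → ℝ) => H q.1 q.2) (t, x) (0, Pi.single i 1) := by
  have h := ((hH.differentiable one_ne_zero (t, x)).hasFDerivAt).comp x
    (hasFDerivAt_prodMk_right t x)
  have h' : fderiv ℝ (H t) x = _ := h.fderiv
  simp [pd, h']

/-- Time and space derivatives commute. -/
theorem deriv_pd_comm {H : ℝ → (Fin 3 → ℝ) → ℝ}
    (hH : ContDiff ℝ 2 fun q : ℝ × (Fin 3 → ℝ) => H q.1 q.2) (i : Fin 3) (t : ℝ)
    (x : Fin 3 → ℝ) :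
    deriv (fun s => pd i (H s) x) t = pd i (fun y => deriv (fun s => H s y) t) x := by
  have h1 : ContDiff ℝ 1 fun q : ℝ × (Fin 3 → ℝ) => H q.1 q.2 := hH.of_le (by norm_num)
  have hv : ∀ v : ℝ × (Fin 3 → ℝ), ContDiff ℝ 1 fun q : ℝ × (Fin 3 → ℝ) =>
      fderiv ℝ (fun q : ℝ × (Fin 3 → ℝ) => H q.1 q.2) q v := fun v =>
    (hH.fderiv_right (m := 1) (by norm_num)).clm_apply contDiff_const
  simp only [pd_eq_fderiv_uncurry h1, (hasDerivAt_time h1 _ _).deriv]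
  rw [(hasDerivAt_time (H := fun s y => fderiv ℝ (fun q : ℝ × (Fin 3 → ℝ) => H q.1 q.2) (s, y)
    (0, Pi.single i 1)) (hv _) t x).deriv,
    pd_eq_fderiv_uncurry (H := fun s y => fderiv ℝ (fun q : ℝ × (Fin 3 → ℝ) => H q.1 q.2) (s, y)
    (1, 0)) (hv _)]
  exact fderiv_fderiv_apply_comm hH _ _ _

theorem contDiff_pd {f : (Fin 3 → ℝ) → ℝ} (hf : ContDiff ℝ (⊤ : ℕ∞) f) (i : Fin 3) :
    ContDiff ℝ (⊤ : ℕ∞) (pd i f) :=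
  (hf.fderiv_right (m := (⊤ : ℕ∞)) (by simp)).clm_apply contDiff_const

theorem contDiff_pd_uncurry {H : ℝ → (Fin 3 → ℝ) → ℝ}
    (hH : ContDiff ℝ (⊤ : ℕ∞) fun q : ℝ × (Fin 3 → ℝ) => H q.1 q.2) (i : Fin 3) :
    ContDiff ℝ (⊤ : ℕ∞) fun q : ℝ × (Fin 3 → ℝ) => pd i (H q.1) q.2 := by
  have h1 : ContDiff ℝ 1 fun q : ℝ × (Fin 3 → ℝ) => H q.1 q.2 := hH.of_le (by exact_mod_cast le_top)
  simp only [pd_eq_fderiv_uncurry h1]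
  exact (hH.fderiv_right (m := (⊤ : ℕ∞)) (by simp)).clm_apply contDiff_const

theorem contDiff_deriv_time {H : ℝ → (Fin 3 → ℝ) → ℝ}
    (hH : ContDiff ℝ (⊤ : ℕ∞) fun q : ℝ × (Fin 3 → ℝ) => H q.1 q.2) (t : ℝ) :
    ContDiff ℝ (⊤ : ℕ∞) fun x => deriv (fun s => H s x) t := by
  have h1 : ContDiff ℝ 1 fun q : ℝ × (Fin 3 → ℝ) => H q.1 q.2 := hH.of_le (by exact_mod_cast le_top)
  simp only [(hasDerivAt_time h1 _ _).deriv]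
  exact ((hH.fderiv_right (m := (⊤ : ℕ∞)) (by simp)).clm_apply contDiff_const).comp
    (contDiff_prodMk_right t)

theorem sqrt_le_exp_mul_sqrt_of_energy {E D : ℝ → ℝ} {r : ℝ}
    (hE : ∀ t, 0 ≤ t → HasDerivAt E (-2 * D t) t) (hD : ∀ t, 0 ≤ t → r * E t ≤ D t) {t : ℝ}
    (ht : 0 ≤ t) : √(E t) ≤ rexp (-(r * t)) * √(E 0) := by
  have hG : ∀ s, 0 ≤ s → HasDerivAt (fun s => rexp (2 * r * s) * E s)
      (2 * rexp (2 * r * s) * (r * E s - D s)) s := by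
    intro s hs
    have h1 : HasDerivAt (fun s : ℝ => 2 * r * s) (2 * r * 1) s := (hasDerivAt_id s).const_mul _
    exact (h1.exp.mul (hE s hs)).congr_deriv (by ring)
  have hanti : AntitoneOn (fun s => rexp (2 * r * s) * E s) (Ici 0) := by
    refine antitoneOn_of_deriv_nonpos (convex_Ici 0)
      (fun s hs => (hG s hs).continuousAt.continuousWithinAt)
      (fun s hs => ?_) (fun s hs => ?_) <;> rw [interior_Ici] at hs
    · exact (hG s (le_of_lt hs)).differentiableAt.differentiableWithinAt
    · rw [(hG s (le_of_lt hs)).deriv]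
      exact mul_nonpos_of_nonneg_of_nonpos (by positivity)
        (sub_nonpos.2 (hD s (le_of_lt hs)))
  have h0 := hanti (mem_Ici.2 le_rfl) (mem_Ici.2 ht) ht
  simp only [mul_zero, Real.exp_zero, one_mul] at h0
  have h1 : E t ≤ rexp (-(r * t)) ^ 2 * E 0 := by
    have h2 := mul_le_mul_of_nonneg_left h0 (sq_nonneg (rexp (-(r * t))))
    have h3 : rexp (-(r * t)) ^ 2 * (rexp (2 * r * t) * E t) = E t := by
      rw [← mul_assoc, ← Real.exp_nat_mul, ← Real.exp_add]
      rw [show ((2 : ℕ) : ℝ) * -(r * t) + 2 * r * t = 0 by push_cast; ring, Real.exp_zero, one_mul]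
    linarith
  calc √(E t) ≤ √(rexp (-(r * t)) ^ 2 * E 0) := Real.sqrt_le_sqrt h1
    _ = _ := by rw [Real.sqrt_mul (sq_nonneg _), Real.sqrt_sq (Real.exp_pos _).le]

/-- Weighted coercivity: the weighted variance is controlled by a dissipation `∇f · G` that is
elliptic up to the factor `c₁`. -/
theorem weighted_slab_poincare {L₁ L₂ d c₀ c₁ : ℝ} (hd : 0 < d) (hL₁ : 0 < L₁) (hL₂ : 0 < L₂)
    (hc₀ : 0 < c₀) (hc₁ : 0 < c₁) {f J D : (Fin 3 → ℝ) → ℝ} (hf : ContDiff ℝ 1 f)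
    (hper1 : ∀ x, f (x + Pi.single 0 L₁) = f x) (hper2 : ∀ x, f (x + Pi.single 1 L₂) = f x)
    (hJc : Continuous J) (hJ0 : ∀ x, 0 ≤ J x) (hJ : ∀ x, J x ≤ c₀) (hDc : Continuous D)
    (hD : ∀ x, 1 / c₁ * ∑ i, pd i f x ^ 2 ≤ D x)
    (hmean : ∫ x in slab L₁ L₂ d, f x * J x = 0) :
    π ^ 2 * min (1 / d ^ 2) (min (4 / L₁ ^ 2) (4 / L₂ ^ 2)) / (c₀ * c₁) *
      ∫ x in slab L₁ L₂ d, f x ^ 2 * J x ≤ ∫ x in slab L₁ L₂ d, D x := by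
  have hfc := hf.continuous
  have hvol : 0 < L₁ * L₂ * d := by positivity
  obtain ⟨m, hm⟩ : ∃ m, m = (∫ x in slab L₁ L₂ d, f x) / (L₁ * L₂ * d) := ⟨_, rfl⟩
  have hshift : ∫ x in slab L₁ L₂ d, f x ^ 2 * J x ≤
      ∫ x in slab L₁ L₂ d, (f x - m) ^ 2 * J x := by
    have e : ∀ x, (f x - m) ^ 2 * J x = f x ^ 2 * J x - 2 * m * (f x * J x) + m ^ 2 * J x := by
      intro x; ring
    simp only [e]
    rw [integral_add (Continuous.integrableOn_slab (by fun_prop))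
      (Continuous.integrableOn_slab (by fun_prop)),
      integral_sub (Continuous.integrableOn_slab (by fun_prop))
      (Continuous.integrableOn_slab (by fun_prop)), integral_const_mul, hmean]
    have : 0 ≤ ∫ x in slab L₁ L₂ d, m ^ 2 * J x :=
      integral_nonneg fun x => mul_nonneg (sq_nonneg m) (hJ0 x)
    linarith
  have hvar : ∫ x in slab L₁ L₂ d, (f x - m) ^ 2 * J x ≤
      c₀ * ((∫ x in slab L₁ L₂ d, f x ^ 2) -
        (∫ x in slab L₁ L₂ d, f x) ^ 2 / (L₁ * L₂ * d)) := by
    have e : ∀ x, c₀ * (f x - m) ^ 2 = c₀ * f x ^ 2 - 2 * c₀ * m * f x + c₀ * m ^ 2 := by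
      intro x; ring
    have hle : ∫ x in slab L₁ L₂ d, (f x - m) ^ 2 * J x ≤
        ∫ x in slab L₁ L₂ d, c₀ * (f x - m) ^ 2 :=
      integral_mono (Continuous.integrableOn_slab (by fun_prop))
        (Continuous.integrableOn_slab (by fun_prop)) fun x => by
          rw [mul_comm]; exact mul_le_mul_of_nonneg_right (hJ x) (sq_nonneg _)
    refine hle.trans_eq ?_
    simp only [e]
    rw [integral_add (Continuous.integrableOn_slab (by fun_prop))
      (Continuous.integrableOn_slab (by fun_prop)),
      integral_sub (Continuous.integrableOn_slab (by fun_prop))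
      (Continuous.integrableOn_slab (by fun_prop)), integral_const_mul, integral_const_mul,
      setIntegral_const, volume_slab hd hL₁ hL₂, smul_eq_mul, hm]
    field_simp
    ring
  have hgrad : 1 / c₁ * ∫ x in slab L₁ L₂ d, ∑ i, pd i f x ^ 2 ≤ ∫ x in slab L₁ L₂ d, D x := by
    have hc : Continuous fun x => ∑ i, pd i f x ^ 2 :=
      continuous_finsetSum _ fun i _ => (continuous_pd hf i).pow 2
    rw [← integral_const_mul]
    exact integral_mono (continuous_const.mul hc).integrableOn_slab hDc.integrableOn_slab hD
  have hpoin := slab_poincare hd hL₁ hL₂ hf hper1 hper2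
  have hmin : 0 ≤ π ^ 2 * min (1 / d ^ 2) (min (4 / L₁ ^ 2) (4 / L₂ ^ 2)) := by positivity
  refine (mul_le_mul_of_nonneg_left (hshift.trans hvar) (by positivity)).trans
    (le_trans ?_ hgrad)
  refine le_trans (le_of_eq ?_) (mul_le_mul_of_nonneg_left hpoin (by positivity))
  field_simp

/-- Exponential decay for an advection-diffusion equation in conservative form on the slab, with
density `J`, mass flux `V` and diffusive flux `G`. -/
theorem sqrt_energy_le_of_conservative {L₁ L₂ d κ c₀ c₁ : ℝ} (hd : 0 < d) (hL₁ : 0 < L₁)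
    (hL₂ : 0 < L₂) (hκ : 0 < κ) (hc₀ : 0 < c₀) (hc₁ : 0 < c₁) {w J : ℝ → (Fin 3 → ℝ) → ℝ}
    (hw : ContDiff ℝ 1 fun q : ℝ × (Fin 3 → ℝ) => w q.1 q.2)
    (hJ : ContDiff ℝ 1 fun q : ℝ × (Fin 3 → ℝ) => J q.1 q.2)
    (hw_per1 : ∀ t x, w t (x + Pi.single 0 L₁) = w t x)
    (hw_per2 : ∀ t x, w t (x + Pi.single 1 L₂) = w t x)
    (hJ0 : ∀ t x, 0 ≤ J t x) (hJc₀ : ∀ t x, J t x ≤ c₀)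
    {V G : ℝ → Fin 3 → (Fin 3 → ℝ) → ℝ} (hV : ∀ t i, ContDiff ℝ 1 (V t i))
    (hG : ∀ t i, ContDiff ℝ 1 (G t i))
    (hV_per1 : ∀ t i x, V t i (x + Pi.single 0 L₁) = V t i x)
    (hV_per2 : ∀ t i x, V t i (x + Pi.single 1 L₂) = V t i x)
    (hG_per1 : ∀ t i x, G t i (x + Pi.single 0 L₁) = G t i x)
    (hG_per2 : ∀ t i x, G t i (x + Pi.single 1 L₂) = G t i x)
    (hV_top : ∀ t, 0 ≤ t → ∀ x : Fin 3 → ℝ, x 2 = 0 → V t 2 x = 0)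
    (hV_bot : ∀ t, 0 ≤ t → ∀ x : Fin 3 → ℝ, x 2 = -d → V t 2 x = 0)
    (hG_top : ∀ t, 0 ≤ t → ∀ x : Fin 3 → ℝ, x 2 = 0 → G t 2 x = 0)
    (hG_bot : ∀ t, 0 ≤ t → ∀ x : Fin 3 → ℝ, x 2 = -d → G t 2 x = 0)
    (hmass : ∀ t, 0 ≤ t → ∀ x ∈ slab L₁ L₂ d,
      deriv (fun s => J s x) t + ∑ i, pd i (V t i) x = 0)
    (hevol : ∀ t, 0 ≤ t → ∀ x ∈ slab L₁ L₂ d,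
      J t x * deriv (fun s => w s x) t + ∑ i, V t i x * pd i (w t) x =
        κ * ∑ i, pd i (G t i) x)
    (hell : ∀ t x, 1 / c₁ * ∑ i, pd i (w t) x ^ 2 ≤ ∑ i, G t i x * pd i (w t) x)
    (hmean : ∫ x in slab L₁ L₂ d, w 0 x * J 0 x = 0) {t : ℝ} (ht : 0 ≤ t) :
    √(∫ x in slab L₁ L₂ d, w t x ^ 2 * J t x) ≤
      rexp (-(κ * (π ^ 2 * min (1 / d ^ 2) (min (4 / L₁ ^ 2) (4 / L₂ ^ 2)) / (c₀ * c₁)) * t)) *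
        √(∫ x in slab L₁ L₂ d, w 0 x ^ 2 * J 0 x) := by
  have hwt : ∀ t, ContDiff ℝ 1 (w t) := fun t => hw.comp (contDiff_prodMk_right t)
  have hJt : ∀ t, ContDiff ℝ 1 (J t) := fun t => hJ.comp (contDiff_prodMk_right t)
  have hwd : ∀ t, Differentiable ℝ (w t) := fun t => (hwt t).differentiable one_ne_zero
  have hVd : ∀ t i, Differentiable ℝ (V t i) := fun t i => (hV t i).differentiable one_ne_zero
  have hGd : ∀ t i, Differentiable ℝ (G t i) := fun t i => (hG t i).differentiable one_ne_zero
  have hdw : ∀ t x, HasDerivAt (fun s => w s x) (deriv (fun s => w s x) t) t := fun t x =>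
    (hasDerivAt_time hw t x).differentiableAt.hasDerivAt
  have hdJ : ∀ t x, HasDerivAt (fun s => J s x) (deriv (fun s => J s x) t) t := fun t x =>
    (hasDerivAt_time hJ t x).differentiableAt.hasDerivAt
  have hDc : ∀ t, Continuous fun x => ∑ i, G t i x * pd i (w t) x := fun t =>
    continuous_finsetSum _ fun i _ => (hG t i).continuous.mul (continuous_pd (hwt t) i)
  have hmass' : ∀ s, 0 ≤ s → HasDerivAt (fun s => ∫ x in slab L₁ L₂ d, w s x * J s x) 0 s := by
    intro s hs
    have := hasDerivAt_integral_slab_of_balance hd hL₁ hL₂ (H := fun s x => w s x * J s x)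
      (hw.mul hJ) (t := s) (F := fun i x => κ * G s i x - w s x * V s i x) (R := fun _ => 0)
      (fun i => (contDiff_const.mul (hG s i)).sub ((hwt s).mul (hV s i))) continuous_const
      (fun x => by simp only [hG_per1, hw_per1, hV_per1])
      (fun x => by simp only [hG_per2, hw_per2, hV_per2])
      (fun x hx => by simp only [hG_top s hs x hx, hV_top s hs x hx, mul_zero, sub_zero])
      (fun x hx => by simp only [hG_bot s hs x hx, hV_bot s hs x hx, mul_zero, sub_zero])
      (fun x hx => by
        have h1 := hmass s hs x hx
        have h2 := hevol s hs x hx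
        have e : ∀ i, pd i (fun x => κ * G s i x - w s x * V s i x) x =
            κ * pd i (G s i) x - (w s x * pd i (V s i) x + V s i x * pd i (w s) x) := by
          intro i
          rw [pd_sub ((hGd s i).const_mul κ) ((hwd s).fun_mul (hVd s i)),
            pd_mul (hwd s) (hVd s i), pd_mul (differentiable_const κ) (hGd s i), pd_const,
            mul_zero, add_zero]
        rw [((hdw s x).fun_mul (hdJ s x)).deriv]
        simp only [e, Fin.sum_univ_three] at h1 h2 ⊢
        linear_combination w s x * h1 + h2)
    simpa using this
  have hzero : ∀ s, 0 ≤ s → ∫ x in slab L₁ L₂ d, w s x * J s x = 0 := by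
    intro s hs
    rw [← hmean]
    exact constant_of_has_deriv_right_zero
      (fun r hr => (hmass' r hr.1).continuousAt.continuousWithinAt)
      (fun r hr => (hmass' r hr.1).hasDerivWithinAt) s ⟨hs, le_rfl⟩
  refine sqrt_le_exp_mul_sqrt_of_energy
    (E := fun t => ∫ x in slab L₁ L₂ d, w t x ^ 2 * J t x)
    (D := fun t => κ * ∫ x in slab L₁ L₂ d, ∑ i, G t i x * pd i (w t) x)
    (fun s hs => ?_) (fun s hs => ?_) ht
  · have := hasDerivAt_integral_slab_of_balance hd hL₁ hL₂ (H := fun s x => w s x ^ 2 * J s x)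
      ((hw.pow 2).mul hJ) (t := s)
      (F := fun i x => 2 * κ * (w s x * G s i x) - w s x * (w s x * V s i x))
      (R := fun x => -(2 * κ) * ∑ i, G s i x * pd i (w s) x)
      (fun i => (contDiff_const.mul ((hwt s).mul (hG s i))).sub
        ((hwt s).mul ((hwt s).mul (hV s i))))
      (continuous_const.mul (hDc s))
      (fun x => by simp only [hG_per1, hw_per1, hV_per1])
      (fun x => by simp only [hG_per2, hw_per2, hV_per2])
      (fun x hx => by simp only [hG_top s hs x hx, hV_top s hs x hx, mul_zero, sub_zero])
      (fun x hx => by simp only [hG_bot s hs x hx, hV_bot s hs x hx, mul_zero, sub_zero])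
      (fun x hx => by
        have h1 := hmass s hs x hx
        have h2 := hevol s hs x hx
        have e : ∀ i, pd i (fun x => 2 * κ * (w s x * G s i x) - w s x * (w s x * V s i x)) x =
            2 * κ * (w s x * pd i (G s i) x + G s i x * pd i (w s) x) -
            (w s x * (w s x * pd i (V s i) x + V s i x * pd i (w s) x) +
              w s x * V s i x * pd i (w s) x) := by
          intro i
          rw [pd_sub (((hwd s).fun_mul (hGd s i)).const_mul (2 * κ))
            ((hwd s).fun_mul ((hwd s).fun_mul (hVd s i))),
            pd_mul (hwd s) ((hwd s).fun_mul (hVd s i)), pd_mul (hwd s) (hVd s i),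
            pd_mul (differentiable_const (2 * κ)) ((hwd s).fun_mul (hGd s i)),
            pd_mul (hwd s) (hGd s i), pd_const, mul_zero, add_zero]
        rw [(((hdw s x).fun_pow 2).fun_mul (hdJ s x)).deriv]
        simp only [e, Fin.sum_univ_three] at h1 h2 ⊢
        simp only [Nat.cast_ofNat, Nat.add_one_sub_one, pow_one]
        linear_combination w s x ^ 2 * h1 + 2 * w s x * h2)
    refine this.congr_deriv ?_
    rw [integral_const_mul]
    ring
  · rw [mul_assoc]
    exact mul_le_mul_of_nonneg_left (weighted_slab_poincare hd hL₁ hL₂ hc₀ hc₁ (hwt s)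
      (hw_per1 s) (hw_per2 s) (hJt s).continuous (hJ0 s) (hJc₀ s) (hDc s) (hell s)
      (hzero s hs)) hκ.le

theorem pd_comm {f : (Fin 3 → ℝ) → ℝ} (hf : ContDiff ℝ 2 f) (i j : Fin 3) (x : Fin 3 → ℝ) :
    pd i (pd j f) x = pd j (pd i f) x :=
  fderiv_fderiv_apply_comm hf x _ _

/-- The Piola transform of the vector field `a` under the vertical deformation
`x ↦ (x₁, x₂, x₃ + ψ x)`. -/
def piola (ψ : (Fin 3 → ℝ) → ℝ) (a : Fin 3 → (Fin 3 → ℝ) → ℝ) : Fin 3 → (Fin 3 → ℝ) → ℝ :=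
  ![fun y => (1 + pd 2 ψ y) * a 0 y, fun y => (1 + pd 2 ψ y) * a 1 y,
    fun y => a 2 y - pd 0 ψ y * a 0 y - pd 1 ψ y * a 1 y]

theorem contDiff_piola {ψ : (Fin 3 → ℝ) → ℝ} (hψ : ContDiff ℝ (⊤ : ℕ∞) ψ)
    {a : Fin 3 → (Fin 3 → ℝ) → ℝ} (ha : ∀ i, ContDiff ℝ 1 (a i)) (i : Fin 3) :
    ContDiff ℝ 1 (piola ψ a i) := by
  have hpd : ∀ i, ContDiff ℝ 1 (pd i ψ) := fun i =>
    (contDiff_pd hψ i).of_le (by exact_mod_cast le_top)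
  fin_cases i
  · exact (contDiff_const.add (hpd 2)).mul (ha 0)
  · exact (contDiff_const.add (hpd 2)).mul (ha 1)
  · exact ((ha 2).sub ((hpd 0).mul (ha 0))).sub ((hpd 1).mul (ha 1))

theorem piola_add_right {ψ : (Fin 3 → ℝ) → ℝ} {a : Fin 3 → (Fin 3 → ℝ) → ℝ} {v : Fin 3 → ℝ}
    (hψ : ∀ x, ψ (x + v) = ψ x) (ha : ∀ i x, a i (x + v) = a i x) (i : Fin 3) (x : Fin 3 → ℝ) :
    piola ψ a i (x + v) = piola ψ a i x := by
  fin_cases i <;> simp [piola, pd_add_right hψ, ha]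

/-- Piola's identity. -/
theorem sum_pd_piola {ψ : (Fin 3 → ℝ) → ℝ} (hψ : ContDiff ℝ (⊤ : ℕ∞) ψ)
    {a : Fin 3 → (Fin 3 → ℝ) → ℝ} (ha : ∀ i, ContDiff ℝ 1 (a i)) (x : Fin 3 → ℝ) :
    ∑ i, pd i (piola ψ a i) x = (1 + pd 2 ψ x) * (pd 0 (a 0) x + pd 1 (a 1) x) +
      pd 2 (a 2) x - pd 0 ψ x * pd 2 (a 0) x - pd 1 ψ x * pd 2 (a 1) x := by
  have hpd : ∀ i, Differentiable ℝ (pd i ψ) := fun i =>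
    (contDiff_pd hψ i).differentiable (by simp)
  have had : ∀ i, Differentiable ℝ (a i) := fun i => (ha i).differentiable one_ne_zero
  have hψ2 : ContDiff ℝ 2 ψ := hψ.of_le (WithTop.coe_le_coe.2 le_top)
  have h1 : ∀ i j : Fin 3, pd i (fun y => (1 + pd 2 ψ y) * a j y) x =
      (1 + pd 2 ψ x) * pd i (a j) x + a j x * pd i (pd 2 ψ) x := by
    intro i j
    rw [pd_mul ((hpd 2).const_add 1) (had j), pd_add (differentiable_const 1) (hpd 2), pd_const,
      zero_add]
  have h2 : pd 2 (fun y => a 2 y - pd 0 ψ y * a 0 y - pd 1 ψ y * a 1 y) x =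
      pd 2 (a 2) x - (pd 0 ψ x * pd 2 (a 0) x + a 0 x * pd 2 (pd 0 ψ) x) -
        (pd 1 ψ x * pd 2 (a 1) x + a 1 x * pd 2 (pd 1 ψ) x) := by
    rw [pd_sub ((had 2).fun_sub ((hpd 0).fun_mul (had 0))) ((hpd 1).fun_mul (had 1)),
      pd_sub (had 2) ((hpd 0).fun_mul (had 0)), pd_mul (hpd 0) (had 0), pd_mul (hpd 1) (had 1)]
  rw [Fin.sum_univ_three]
  change pd 0 (fun y => (1 + pd 2 ψ y) * a 0 y) x + pd 1 (fun y => (1 + pd 2 ψ y) * a 1 y) x +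
    pd 2 (fun y => a 2 y - pd 0 ψ y * a 0 y - pd 1 ψ y * a 1 y) x = _
  rw [h1, h1, h2, pd_comm hψ2 0 2, pd_comm hψ2 1 2]
  ring

theorem pd_mul_one_add_div {f : (Fin 3 → ℝ) → ℝ} (hf : Differentiable ℝ f) (d : ℝ) (i : Fin 3)
    (x : Fin 3 → ℝ) : pd i (fun y => f y * (1 + y 2 / d)) x =
      f x * ((Pi.single i 1 : Fin 3 → ℝ) 2 / d) + (1 + x 2 / d) * pd i f x := by
  have h : HasFDerivAt (fun y : Fin 3 → ℝ => 1 + y 2 / d)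
      (d⁻¹ • ContinuousLinearMap.proj (R := ℝ) (φ := fun _ : Fin 3 => ℝ) 2) x := by
    simpa only [div_eq_mul_inv] using
      ((hasFDerivAt_apply (𝕜 := ℝ) (2 : Fin 3) x).mul_const d⁻¹).const_add 1
  rw [pd_mul hf (by fun_prop)]
  congr 2
  rw [pd, h.fderiv]
  simp [div_eq_inv_mul]

/-- **Exponential equilibration of the insulating passive scalar over a moving
boundary (flattened coordinates).**  Under uniform bounds `1/c₀ ≤ J ≤ c₀` and
`(1/c₁)|v|² ≤ (J𝒜ᵀ𝒜v)·v ≤ c₁|v|²`, with `θ_avg = (∫_Ω J(0))⁻¹ ∫_Ω θ(0)J(0)` and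
`μ̄₀ = κπ² min{1/d², 4/L₁², 4/L₂²}`, for all `t ≥ 0`,
`‖(θ(t)−θ_avg)√J(t)‖_{L²(Ω)} ≤ e^{−(μ̄₀/(c₀c₁))t} ‖(θ(0)−θ_avg)√J(0)‖_{L²(Ω)}`. -/
theorem moving_neumann_decay
    (d κ L₁ L₂ c₀ c₁ : ℝ)
    (hd : 0 < d) (hκ : 0 < κ) (hL₁ : 0 < L₁) (hL₂ : 0 < L₂)
    (hc₀ : 1 < c₀) (hc₁ : 0 < c₁)
    (ηb : ℝ → (Fin 3 → ℝ) → ℝ)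
    (hηb_smooth : ContDiff ℝ (⊤ : ℕ∞) (fun q : ℝ × (Fin 3 → ℝ) => ηb q.1 q.2))
    (hη_per1 : ∀ t x, ηb t (x + Pi.single 0 L₁) = ηb t x)
    (hη_per2 : ∀ t x, ηb t (x + Pi.single 1 L₂) = ηb t x)
    (A B J K : ℝ → (Fin 3 → ℝ) → ℝ) (𝒜 : ℝ → (Fin 3 → ℝ) → Matrix (Fin 3) (Fin 3) ℝ)
    (hA : ∀ t x, A t x = pd 0 (ηb t) x * (1 + x 2 / d))
    (hB : ∀ t x, B t x = pd 1 (ηb t) x * (1 + x 2 / d))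
    (hJ : ∀ t x, J t x = 1 + ηb t x / d + pd 2 (ηb t) x * (1 + x 2 / d))
    (hK : ∀ t x, K t x = (J t x)⁻¹)
    (h𝒜 : ∀ t x, 𝒜 t x =
      !![1, 0, -(A t x * K t x); 0, 1, -(B t x * K t x); 0, 0, K t x])
    (hJbd : ∀ t x, 1 / c₀ ≤ J t x ∧ J t x ≤ c₀)
    (hc₁bd : ∀ t x, ∀ v : Fin 3 → ℝ,
      (1 / c₁) * (∑ i, (v i) ^ 2) ≤ J t x * ∑ i, (∑ k, 𝒜 t x i k * v k) ^ 2 ∧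
      J t x * (∑ i, (∑ k, 𝒜 t x i k * v k) ^ 2) ≤ c₁ * ∑ i, (v i) ^ 2)
    (u : ℝ → (Fin 3 → ℝ) → (Fin 3 → ℝ)) (θ : ℝ → (Fin 3 → ℝ) → ℝ)
    (hu_smooth : ContDiff ℝ (⊤ : ℕ∞) (fun q : ℝ × (Fin 3 → ℝ) => u q.1 q.2))
    (hθ_smooth : ContDiff ℝ (⊤ : ℕ∞) (fun q : ℝ × (Fin 3 → ℝ) => θ q.1 q.2))
    (hθ_bdd : ∃ M, ∀ t x, |θ t x| ≤ M)
    (hu_per1 : ∀ t x, u t (x + Pi.single 0 L₁) = u t x)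
    (hu_per2 : ∀ t x, u t (x + Pi.single 1 L₂) = u t x)
    (hθ_per1 : ∀ t x, θ t (x + Pi.single 0 L₁) = θ t x)
    (hθ_per2 : ∀ t x, θ t (x + Pi.single 1 L₂) = θ t x)
    (hdivA : ∀ t, 0 ≤ t → ∀ x ∈ slab L₁ L₂ d,
      (∑ j, ∑ k, 𝒜 t x j k * pd k (fun y => u t y j) x) = 0)
    (hkin : ∀ t, 0 ≤ t → ∀ p : ℝ × ℝ,
      deriv (fun s => ηb s ![p.1, p.2, 0]) t =
        u t ![p.1, p.2, 0] 2
          - u t ![p.1, p.2, 0] 0 * pd 0 (ηb t) ![p.1, p.2, 0]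
          - u t ![p.1, p.2, 0] 1 * pd 1 (ηb t) ![p.1, p.2, 0])
    (hu_bot : ∀ t, 0 ≤ t → ∀ p : ℝ × ℝ, u t ![p.1, p.2, -d] = 0)
    (hpde : ∀ t, 0 ≤ t → ∀ x ∈ slab L₁ L₂ d,
      deriv (fun s => θ s x) t
          - deriv (fun s => ηb s x) t * (1 + x 2 / d) * K t x * pd 2 (θ t) x
          + (∑ j, u t x j * ∑ k, 𝒜 t x j k * pd k (θ t) x)
        = κ * ∑ j, ∑ l, 𝒜 t x j l *
            pd l (fun y => ∑ k, 𝒜 t y j k * pd k (θ t) y) x)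
    (hbc_top : ∀ t, 0 ≤ t → ∀ p : ℝ × ℝ,
      (∑ k, 𝒜 t ![p.1, p.2, 0] 0 k * pd k (θ t) ![p.1, p.2, 0]) *
          (-(pd 0 (ηb t) ![p.1, p.2, 0]))
        + (∑ k, 𝒜 t ![p.1, p.2, 0] 1 k * pd k (θ t) ![p.1, p.2, 0]) *
          (-(pd 1 (ηb t) ![p.1, p.2, 0]))
        + (∑ k, 𝒜 t ![p.1, p.2, 0] 2 k * pd k (θ t) ![p.1, p.2, 0]) = 0)
    (hbc_bot : ∀ t, 0 ≤ t → ∀ p : ℝ × ℝ, pd 2 (θ t) ![p.1, p.2, -d] = 0)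
    (θavg μ₀ : ℝ)
    (hθavg : θavg =
      (∫ x in slab L₁ L₂ d, J 0 x)⁻¹ * ∫ x in slab L₁ L₂ d, θ 0 x * J 0 x)
    (hμ₀ : μ₀ = κ * π ^ 2 * min (1 / d ^ 2) (min (4 / L₁ ^ 2) (4 / L₂ ^ 2))) :
    ∀ t, 0 ≤ t →
      Real.sqrt (∫ x in slab L₁ L₂ d, (θ t x - θavg) ^ 2 * J t x) ≤
        Real.exp (-(μ₀ / (c₀ * c₁) * t)) *
          Real.sqrt (∫ x in slab L₁ L₂ d, (θ 0 x - θavg) ^ 2 * J 0 x) := by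
  obtain ⟨ψ, hψ⟩ : ∃ ψ : ℝ → (Fin 3 → ℝ) → ℝ, ψ = fun t x => ηb t x * (1 + x 2 / d) := ⟨_, rfl⟩
  have hψ_smooth : ContDiff ℝ (⊤ : ℕ∞) fun q : ℝ × (Fin 3 → ℝ) => ψ q.1 q.2 := by
    rw [hψ]
    exact hηb_smooth.mul (by fun_prop)
  have hηbt : ∀ t, ContDiff ℝ (⊤ : ℕ∞) (ηb t) := fun t =>
    hηb_smooth.comp (contDiff_prodMk_right t)
  have hηbd : ∀ t, Differentiable ℝ (ηb t) := fun t => (hηbt t).differentiable (by simp)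
  have hψt : ∀ t, ContDiff ℝ (⊤ : ℕ∞) (ψ t) := fun t =>
    hψ_smooth.comp (contDiff_prodMk_right t)
  have hθt : ∀ t, ContDiff ℝ (⊤ : ℕ∞) (θ t) := fun t =>
    hθ_smooth.comp (contDiff_prodMk_right t)
  have hut : ∀ t j, ContDiff ℝ (⊤ : ℕ∞) fun y => u t y j := fun t j =>
    (contDiff_apply ℝ ℝ j).comp (hu_smooth.comp (contDiff_prodMk_right t))
  have hψ_per1 : ∀ t x, ψ t (x + Pi.single 0 L₁) = ψ t x := by simp [hψ, hη_per1]
  have hψ_per2 : ∀ t x, ψ t (x + Pi.single 1 L₂) = ψ t x := by simp [hψ, hη_per2]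
  have hAψ : ∀ t, A t = pd 0 (ψ t) := fun t => funext fun x => by
    rw [hA, hψ, pd_mul_one_add_div (hηbd t)]; simp; ring
  have hBψ : ∀ t, B t = pd 1 (ψ t) := fun t => funext fun x => by
    rw [hB, hψ, pd_mul_one_add_div (hηbd t)]; simp; ring
  have hJψ : ∀ t, J t = fun x => 1 + pd 2 (ψ t) x := fun t => funext fun x => by
    rw [hJ, hψ, pd_mul_one_add_div (hηbd t)]; simp; ring
  have hJ_smooth : ContDiff ℝ (⊤ : ℕ∞) fun q : ℝ × (Fin 3 → ℝ) => J q.1 q.2 := by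
    simp only [hJψ]
    exact contDiff_const.add (contDiff_pd_uncurry hψ_smooth 2)
  have hc₀' : 0 < c₀ := zero_lt_one.trans hc₀
  have hJpos : ∀ t x, 0 < J t x := fun t x => (one_div_pos.2 hc₀').trans_le (hJbd t x).1
  have hJK : ∀ t x, J t x * K t x = 1 := fun t x => by
    rw [hK, mul_inv_cancel₀ (hJpos t x).ne']
  have hAt : ∀ t, ContDiff ℝ (⊤ : ℕ∞) (A t) := fun t => hAψ t ▸ contDiff_pd (hψt t) 0
  have hBt : ∀ t, ContDiff ℝ (⊤ : ℕ∞) (B t) := fun t => hBψ t ▸ contDiff_pd (hψt t) 1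
  have hKt : ∀ t, ContDiff ℝ (⊤ : ℕ∞) (K t) := fun t => by
    rw [funext (hK t)]
    exact (hJ_smooth.comp (contDiff_prodMk_right t)).inv fun x => (hJpos t x).ne'
  have hA_per1 : ∀ t x, A t (x + Pi.single 0 L₁) = A t x := fun t x => by
    rw [hAψ, pd_add_right (hψ_per1 t)]
  have hA_per2 : ∀ t x, A t (x + Pi.single 1 L₂) = A t x := fun t x => by
    rw [hAψ, pd_add_right (hψ_per2 t)]
  have hB_per1 : ∀ t x, B t (x + Pi.single 0 L₁) = B t x := fun t x => by
    rw [hBψ, pd_add_right (hψ_per1 t)]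
  have hB_per2 : ∀ t x, B t (x + Pi.single 1 L₂) = B t x := fun t x => by
    rw [hBψ, pd_add_right (hψ_per2 t)]
  have hK_per1 : ∀ t x, K t (x + Pi.single 0 L₁) = K t x := fun t x => by
    rw [hK, hK]; simp only [hJψ, pd_add_right (hψ_per1 t)]
  have hK_per2 : ∀ t x, K t (x + Pi.single 1 L₂) = K t x := fun t x => by
    rw [hK, hK]; simp only [hJψ, pd_add_right (hψ_per2 t)]
  obtain ⟨g, hg⟩ : ∃ g : ℝ → Fin 3 → (Fin 3 → ℝ) → ℝ, g = fun t =>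
      ![fun y => pd 0 (θ t) y - A t y * K t y * pd 2 (θ t) y,
        fun y => pd 1 (θ t) y - B t y * K t y * pd 2 (θ t) y,
        fun y => K t y * pd 2 (θ t) y] := ⟨_, rfl⟩
  have h𝒜v : ∀ t x j (v : Fin 3 → ℝ), ∑ k, 𝒜 t x j k * v k =
      (![v 0 - A t x * K t x * v 2, v 1 - B t x * K t x * v 2, K t x * v 2] : Fin 3 → ℝ) j := by
    intro t x j v
    rw [h𝒜]
    fin_cases j <;> simp [Fin.sum_univ_three] <;> ring
  have hg𝒜 : ∀ t j, (fun y => ∑ k, 𝒜 t y j k * pd k (θ t) y) = g t j := by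
    intro t j
    funext y
    rw [h𝒜v t y j fun k => pd k (θ t) y, hg]
    fin_cases j <;> rfl
  have hg_smooth : ∀ t i, ContDiff ℝ 1 (g t i) := by
    intro t i
    have hA1 := (hAt t).of_le (m := 1) (by exact_mod_cast le_top)
    have hB1 := (hBt t).of_le (m := 1) (by exact_mod_cast le_top)
    have hK1 := (hKt t).of_le (m := 1) (by exact_mod_cast le_top)
    have hp : ∀ j, ContDiff ℝ 1 (pd j (θ t)) := fun j =>
      (contDiff_pd (hθt t) j).of_le (by exact_mod_cast le_top)
    rw [hg]
    fin_cases i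
    · exact (hp 0).sub ((hA1.mul hK1).mul (hp 2))
    · exact (hp 1).sub ((hB1.mul hK1).mul (hp 2))
    · exact hK1.mul (hp 2)
  have hg_per1 : ∀ t i x, g t i (x + Pi.single 0 L₁) = g t i x := by
    intro t i x
    rw [hg]
    fin_cases i <;> simp [hA_per1, hB_per1, hK_per1, pd_add_right (hθ_per1 t)]
  have hg_per2 : ∀ t i x, g t i (x + Pi.single 1 L₂) = g t i x := by
    intro t i x
    rw [hg]
    fin_cases i <;> simp [hA_per2, hB_per2, hK_per2, pd_add_right (hθ_per2 t)]
  obtain ⟨a, ha⟩ : ∃ a : ℝ → Fin 3 → (Fin 3 → ℝ) → ℝ, a = fun t =>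
      ![fun y => u t y 0, fun y => u t y 1,
        fun y => u t y 2 - deriv (fun s => ψ s y) t] := ⟨_, rfl⟩
  have ha_smooth : ∀ t i, ContDiff ℝ 1 (a t i) := by
    intro t i
    have hu1 : ∀ j, ContDiff ℝ 1 fun y => u t y j := fun j =>
      (hut t j).of_le (by exact_mod_cast le_top)
    rw [ha]
    fin_cases i
    · exact hu1 0
    · exact hu1 1
    · exact (hu1 2).sub ((contDiff_deriv_time hψ_smooth t).of_le (by exact_mod_cast le_top))
  have ha_per1 : ∀ t i x, a t i (x + Pi.single 0 L₁) = a t i x := by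
    intro t i x
    rw [ha]
    fin_cases i <;> simp [hu_per1, hψ_per1]
  have ha_per2 : ∀ t i x, a t i (x + Pi.single 1 L₂) = a t i x := by
    intro t i x
    rw [ha]
    fin_cases i <;> simp [hu_per2, hψ_per2]
  have hψ_time : ∀ t x, deriv (fun s => ψ s x) t =
      deriv (fun s => ηb s x) t * (1 + x 2 / d) := fun t x => by
    rw [hψ, deriv_mul_const]
    exact (hasDerivAt_time (hηb_smooth.of_le (by exact_mod_cast le_top)) t x).differentiableAt
  have htop_eq : ∀ x : Fin 3 → ℝ, x 2 = 0 → x = ![x 0, x 1, 0] := fun x hx => by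
    ext i; fin_cases i <;> simp [hx]
  have hbot_eq : ∀ x : Fin 3 → ℝ, x 2 = -d → x = ![x 0, x 1, -d] := fun x hx => by
    ext i; fin_cases i <;> simp [hx]
  have hbot_zero : ∀ x : Fin 3 → ℝ, x 2 = -d → 1 + x 2 / d = 0 := fun x hx => by
    rw [hx, neg_div, div_self hd.ne']; ring
  have hJ0int : 0 < ∫ x in slab L₁ L₂ d, J 0 x := by
    have hJc : Continuous (J 0) := hJ_smooth.continuous.comp (Continuous.prodMk_right 0)
    calc 0 < L₁ * L₂ * d * (1 / c₀) := by positivity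
      _ = ∫ x in slab L₁ L₂ d, 1 / c₀ := by
        rw [setIntegral_const, volume_slab hd hL₁ hL₂, smul_eq_mul]
      _ ≤ ∫ x in slab L₁ L₂ d, J 0 x :=
        integral_mono continuous_const.integrableOn_slab hJc.integrableOn_slab
          fun x => (hJbd 0 x).1
  have hpdw : ∀ t i x, pd i (fun y => θ t y - θavg) x = pd i (θ t) x := fun t i x => by
    rw [pd_sub ((hθt t).differentiable (by simp)) (differentiable_const _), pd_const, sub_zero]
  intro t ht
  have hmain := sqrt_energy_le_of_conservative hd hL₁ hL₂ hκ hc₀' hc₁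
    (w := fun t x => θ t x - θavg) (J := J) (V := fun t => piola (ψ t) (a t))
    (G := fun t => piola (ψ t) (g t))
    ((hθ_smooth.of_le (by exact_mod_cast le_top)).sub contDiff_const)
    (hJ_smooth.of_le (by exact_mod_cast le_top))
    (fun t x => by rw [hθ_per1]) (fun t x => by rw [hθ_per2])
    (fun t x => (hJpos t x).le) (fun t x => (hJbd t x).2)
    (fun t => contDiff_piola (hψt t) (ha_smooth t))
    (fun t => contDiff_piola (hψt t) (hg_smooth t))
    (fun t => piola_add_right (hψ_per1 t) (ha_per1 t))
    (fun t => piola_add_right (hψ_per2 t) (ha_per2 t))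
    (fun t => piola_add_right (hψ_per1 t) (hg_per1 t))
    (fun t => piola_add_right (hψ_per2 t) (hg_per2 t))
    (fun t ht x hx => by
      have h := hkin t ht (x 0, x 1)
      rw [← htop_eq x hx] at h
      change a t 2 x - pd 0 (ψ t) x * a t 0 x - pd 1 (ψ t) x * a t 1 x = 0
      rw [← hAψ, ← hBψ, hA, hB, ha]
      simp only [Matrix.cons_val, hψ_time, hx, zero_div, add_zero, mul_one, h]
      ring)
    (fun t ht x hx => by
      have h := hu_bot t ht (x 0, x 1)
      rw [← hbot_eq x hx] at h
      change a t 2 x - pd 0 (ψ t) x * a t 0 x - pd 1 (ψ t) x * a t 1 x = 0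
      rw [ha]
      simp [hψ_time, hbot_zero x hx, h])
    (fun t ht x hx => by
      have h := hbc_top t ht (x 0, x 1)
      rw [← htop_eq x hx] at h
      have hgx : ∀ j, ∑ k, 𝒜 t x j k * pd k (θ t) x = g t j x := fun j =>
        congrFun (hg𝒜 t j) x
      rw [hgx, hgx, hgx] at h
      change g t 2 x - pd 0 (ψ t) x * g t 0 x - pd 1 (ψ t) x * g t 1 x = 0
      rw [← hAψ, ← hBψ, hA, hB, hx]
      linear_combination h)
    (fun t ht x hx => by
      have h := hbc_bot t ht (x 0, x 1)
      rw [← hbot_eq x hx] at h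
      change g t 2 x - pd 0 (ψ t) x * g t 0 x - pd 1 (ψ t) x * g t 1 x = 0
      rw [← hAψ, ← hBψ, hA, hB, hbot_zero x hx, hg]
      simp [h])
    (fun t ht x hx => by
      have h := hdivA t ht x hx
      simp only [h𝒜v t x _ fun k => pd k (fun y => u t y _) x] at h
      rw [sum_pd_piola (hψt t) (ha_smooth t), ha]
      have hJt : deriv (fun s => J s x) t = pd 2 (fun y => deriv (fun s => ψ s y) t) x := by
        rw [← deriv_pd_comm (hψ_smooth.of_le (WithTop.coe_le_coe.2 le_top))]
        simp only [hJψ, deriv_const_add]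
      simp only [Fin.sum_univ_three, Matrix.cons_val] at h ⊢
      rw [hJt, pd_sub ((hut t 2).differentiable (by simp))
        ((contDiff_deriv_time hψ_smooth t).differentiable (by simp)), ← hAψ, ← hBψ,
        ← congrFun (hJψ t) x]
      linear_combination J t x * h + (A t x * pd 2 (fun y => u t y 0) x +
        B t x * pd 2 (fun y => u t y 1) x - pd 2 (fun y => u t y 2) x) * hJK t x)
    (fun t ht x hx => by
      have h := hpde t ht x hx
      simp only [hg𝒜] at h
      have hgx : ∀ j, ∑ k, 𝒜 t x j k * pd k (θ t) x = g t j x := fun j =>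
        congrFun (hg𝒜 t j) x
      simp only [hgx, h𝒜v t x _ fun k => pd k (g t _) x] at h
      rw [sum_pd_piola (hψt t) (hg_smooth t)]
      have hV : ∑ i, piola (ψ t) (a t) i x * pd i (fun y => θ t y - θavg) x =
          J t x * (u t x 0 * g t 0 x + u t x 1 * g t 1 x + u t x 2 * g t 2 x)
            - deriv (fun s => ψ s x) t * pd 2 (θ t) x := by
        simp only [Fin.sum_univ_three, hpdw, piola, ← hAψ, ← hBψ, ← congrFun (hJψ t), ha, hg,
          Matrix.cons_val]
        linear_combination (A t x * u t x 0 + B t x * u t x 1 - u t x 2) *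
          pd 2 (θ t) x * hJK t x
      rw [hV, hψ_time, ← hAψ, ← hBψ, ← congrFun (hJψ t) x, deriv_sub_const]
      simp only [Fin.sum_univ_three, Matrix.cons_val] at h
      linear_combination J t x * h + (deriv (fun s => ηb s x) t * (1 + x 2 / d) * pd 2 (θ t) x
        + κ * (pd 2 (g t 2) x - A t x * pd 2 (g t 0) x - B t x * pd 2 (g t 1) x)) * hJK t x)
    (fun t x => by
      have h := (hc₁bd t x fun i => pd i (θ t) x).1
      simp only [hpdw]
      refine h.trans_eq ?_
      simp only [h𝒜v t x _ fun k => pd k (θ t) x]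
      simp only [Fin.sum_univ_three, piola, ← hAψ, ← hBψ, ← congrFun (hJψ t), hg,
        Matrix.cons_val]
      linear_combination (A t x * pd 2 (θ t) x * (A t x * K t x * pd 2 (θ t) x - pd 0 (θ t) x) +
        B t x * pd 2 (θ t) x * (B t x * K t x * pd 2 (θ t) x - pd 1 (θ t) x) +
        K t x * pd 2 (θ t) x ^ 2) * hJK t x)
    (by
      have hJc : Continuous (J 0) := hJ_smooth.continuous.comp (Continuous.prodMk_right 0)
      have hθc : Continuous (θ 0) := (hθt 0).continuous
      simp only [sub_mul]
      rw [integral_sub (Continuous.integrableOn_slab (by fun_prop))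
        (Continuous.integrableOn_slab (by fun_prop)), integral_const_mul, hθavg]
      field_simp
      ring) ht
  convert hmain using 4
  rw [hμ₀]
  ring
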